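/- arXiv:2602.13001 — 6 statements merged into one kernel-verified Lean document; each statement's English description precedes it below -/
import Mathlib

section
/- Let c, d, s be positive integers with d ≥ 2, 1 ≤ c, s ≤ d and gcd(cs, d) = 1, let p ≥ 5 be a prime with p ≡ s (mod d), set α = c/d, let r be a positive integer with (1/2+α)^{*_r} · (1/2 + α^{*_r}) ≢ 0 (mod p), and let a = ⟨−α⟩_{p^r}. Then for every l ∈ {0, 1, …, a−1}: if a < (p^r+1)/2, or if a ≥ (p^r+1)/2 and l < a − (p^r−1)/2, then (1/2+α)_l / (1/2+α+p^r)_l ≡ 1 (mod p); while if a ≥ (p^r+1)/2 and l ≥ a − (p^r−1)/2, then (1/2+α)_l / (1/2+α+p^r)_l ≡ (2α^{*_r} − 1)/(2α^{*_r} + 1) (mod p). -/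
noncomputable section

/-- Pochhammer symbol `(x)_n = x(x+1)⋯(x+n-1)`. -/
def poch (x : ℚ) (n : ℕ) : ℚ := ∏ i ∈ Finset.range n, (x + i)

/-- `n`-th harmonic number of order 2: `H_n^{(2)} = ∑_{k=1}^n 1/k^2`. -/
def H2 (n : ℕ) : ℚ := ∑ k ∈ Finset.Icc 1 n, (1 : ℚ) / (k : ℚ) ^ 2

/-- Least nonnegative residue of a rational `x` (with denominator coprime to `m`)
modulo `m`: the unique integer in `{0, …, m-1}` congruent to `x` mod `m`. -/
def res (m : ℕ) (x : ℚ) : ℕ := ((x.num : ZMod m) * (x.den : ZMod m)⁻¹).val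

/-- Dwork's dash operation: `x* = (x + ⟨-x⟩_p)/p`. -/
def dash (p : ℕ) (x : ℚ) : ℚ := (x + (res p (-x) : ℚ)) / p

/-- `r`-fold iterate of Dwork's dash operation, with `x^{*_0} = x`. -/
def dashIter (p r : ℕ) (x : ℚ) : ℚ := (dash p)^[r] x

/-- For rationals `u, v`, `u ≡ v (mod p^m)` means `u = v` or the `p`-adic
valuation of `u - v` is at least `m`. -/
def ratCongr (p : ℕ) (m : ℤ) (u v : ℚ) : Prop :=
  u = v ∨ m ≤ padicValRat p (u - v)

section helpers

lemma ratCongr_one_iff (p : ℕ) [hp : Fact p.Prime] (u v : ℚ) :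
    ratCongr p 1 u v ↔ padicNorm p (u - v) < 1 := by
  have hp1 : (1 : ℚ) < p := by exact_mod_cast hp.out.one_lt
  unfold ratCongr
  by_cases h : u = v
  · simp [h]
  · have h' : u - v ≠ 0 := sub_ne_zero.2 h
    rw [padicNorm.eq_zpow_of_nonzero h', zpow_lt_one_iff_right₀ hp1]
    simp only [h, false_or]
    omega

lemma norm_prod_sub_one (p : ℕ) [hp : Fact p.Prime] (s : Finset ℕ) (f : ℕ → ℚ)
    (h : ∀ i ∈ s, padicNorm p (f i - 1) < 1) : padicNorm p (∏ i ∈ s, f i - 1) < 1 := by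
  classical
  induction s using Finset.induction_on with
  | empty => simp
  | insert a s ha ih =>
    rw [Finset.prod_insert ha]
    have h1 := h a (Finset.mem_insert_self _ _)
    have h2 := ih (fun i hi => h i (Finset.mem_insert_of_mem hi))
    have hfa : padicNorm p (f a) ≤ 1 := by
      have := padicNorm.nonarchimedean (p := p) (q := f a - 1) (r := 1)
      simp only [sub_add_cancel, padicNorm.one] at this
      exact this.trans (max_le h1.le le_rfl)
    have e : f a * ∏ i ∈ s, f i - 1 = f a * (∏ i ∈ s, f i - 1) + (f a - 1) := by ring
    rw [e]
    refine lt_of_le_of_lt padicNorm.nonarchimedean (max_lt ?_ h1)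
    rw [padicNorm.mul]
    exact lt_of_le_of_lt (mul_le_of_le_one_left (padicNorm.nonneg _) hfa) h2

lemma norm_q (p r : ℕ) [hp : Fact p.Prime] : padicNorm p ((p : ℚ) ^ r) = ((p : ℚ) ^ r)⁻¹ := by
  induction r with
  | zero => simp
  | succ n ih => rw [pow_succ, padicNorm.mul, ih, padicNorm.padicNorm_p_of_prime, mul_inv]

lemma res_lt (p r : ℕ) [hp : Fact p.Prime] (x : ℚ) : res (p ^ r) x < p ^ r := by
  have : NeZero (p ^ r) := ⟨pow_ne_zero _ hp.out.ne_zero⟩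
  exact ZMod.val_lt _

lemma norm_den (p : ℕ) [hp : Fact p.Prime] (x : ℚ) (hx : padicNorm p x ≤ 1) :
    ¬ p ∣ x.den := by
  intro h
  have hn : ¬ (p : ℤ) ∣ x.num := by
    intro h2
    have h3 : p ∣ x.num.natAbs := Int.natCast_dvd.1 h2
    have := Nat.dvd_gcd h3 h
    rw [x.reduced] at this
    exact hp.out.one_lt.ne' (Nat.dvd_one.1 this)
  have h1 : padicNorm p (x.num : ℚ) = 1 := padicNorm.int_eq_one_iff _ |>.2 hn
  have h2 : padicNorm p (x.den : ℚ) < 1 := padicNorm.nat_lt_one_iff _ |>.2 h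
  have h3 : padicNorm p x * padicNorm p (x.den : ℚ) = 1 := by
    rw [← padicNorm.mul, Rat.mul_den_eq_num, h1]
  nlinarith [padicNorm.nonneg (p := p) x, padicNorm.nonneg (p := p) (x.den : ℚ)]

lemma res_spec (p r : ℕ) [hp : Fact p.Prime] (x : ℚ) (hx : padicNorm p x ≤ 1) :
    padicNorm p (x - res (p ^ r) x) ≤ ((p : ℚ) ^ r)⁻¹ := by
  have hd := norm_den p x hx
  have : NeZero (p ^ r) := ⟨pow_ne_zero _ hp.out.ne_zero⟩
  have hco : Nat.Coprime x.den (p ^ r) :=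
    ((Nat.Prime.coprime_iff_not_dvd hp.out).2 hd).symm.pow_right r
  have hz : (((x.num - x.den * res (p ^ r) x : ℤ)) : ZMod (p ^ r)) = 0 := by
    push_cast
    unfold res
    rw [ZMod.natCast_zmod_val]
    have := ZMod.coe_mul_inv_eq_one x.den hco
    linear_combination (-(x.num : ZMod (p ^ r))) * this
  have hdv : ((p ^ r : ℕ) : ℤ) ∣ (x.num - x.den * res (p ^ r) x : ℤ) :=
    (ZMod.intCast_zmod_eq_zero_iff_dvd _ _).1 hz
  have h1 := (padicNorm.dvd_iff_norm_le (p := p)).1 hdv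
  have h2 : padicNorm p (x.den : ℚ) = 1 := padicNorm.nat_eq_one_iff _ |>.2 hd
  have e : ((x.num - x.den * res (p ^ r) x : ℤ) : ℚ) = x.den * (x - res (p ^ r) x) := by
    push_cast
    rw [← Rat.mul_den_eq_num]
    ring
  rw [e, padicNorm.mul, h2, one_mul] at h1
  simpa [zpow_neg] using h1

lemma eq_of_norm (p r : ℕ) [hp : Fact p.Prime] (m n : ℕ) (hm : m < p ^ r) (hn : n < p ^ r)
    (h : padicNorm p ((m : ℚ) - n) ≤ ((p : ℚ) ^ r)⁻¹) : m = n := by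
  have h1 : ((p ^ r : ℕ) : ℤ) ∣ ((m : ℤ) - n) := by
    rw [padicNorm.dvd_iff_norm_le (p := p)]
    push_cast
    simpa [zpow_neg] using h
  have h2 : (n : ℤ) ≡ m [ZMOD ((p ^ r : ℕ) : ℤ)] := (Int.modEq_iff_dvd).2 h1
  have h3 := (Int.natCast_modEq_iff).1 h2
  exact (Nat.ModEq.eq_of_lt_of_lt h3 hn hm).symm

lemma dash_norm (p : ℕ) [hp : Fact p.Prime] (x : ℚ) (hx : padicNorm p x ≤ 1) :
    padicNorm p (dash p x) ≤ 1 := by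
  have hp0 : (0 : ℚ) < p := by exact_mod_cast hp.out.pos
  have h := res_spec p 1 (-x) (by simpa using hx)
  have e : -x - (res (p ^ 1) (-x) : ℚ) = -(x + res p (-x)) := by rw [pow_one]; ring
  rw [e, padicNorm.neg, pow_one] at h
  unfold dash
  rw [padicNorm.div, padicNorm.padicNorm_p_of_prime]
  rw [div_le_one (by positivity)]
  exact h

lemma dashIter_spec (p r : ℕ) [hp : Fact p.Prime] (x : ℚ) (hx : padicNorm p x ≤ 1) :
    padicNorm p (dashIter p r x) ≤ 1 ∧
      ∃ m : ℕ, m < p ^ r ∧ x + m = (p : ℚ) ^ r * dashIter p r x := by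
  have hp0 : (p : ℚ) ≠ 0 := by exact_mod_cast hp.out.ne_zero
  induction r with
  | zero => exact ⟨hx, 0, by simp, by simp [dashIter]⟩
  | succ r ih =>
    obtain ⟨h1, m, hm, he⟩ := ih
    have e : dashIter p (r + 1) x = dash p (dashIter p r x) := by
      unfold dashIter; rw [Function.iterate_succ_apply']
    rw [e]
    refine ⟨dash_norm p _ h1, m + p ^ r * res p (-dashIter p r x), ?_, ?_⟩
    · have := res_lt p 1 (-dashIter p r x)
      rw [pow_one] at this
      calc _ < p ^ r + p ^ r * res p (-dashIter p r x) := by omega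
        _ = p ^ r * (res p (-dashIter p r x) + 1) := by ring
        _ ≤ p ^ r * p := Nat.mul_le_mul_left _ this
        _ = _ := (pow_succ _ _).symm
    · unfold dash
      push_cast
      rw [← add_assoc, he, pow_succ]
      field_simp

lemma term_congr (p r : ℕ) [hp : Fact p.Prime] (β : ℚ) (b i : ℕ) (hb : b < p ^ r)
    (hi : i < p ^ r) (hbi : i ≠ b) (h : padicNorm p (β + b) ≤ ((p : ℚ) ^ r)⁻¹) :
    padicNorm p ((β + i) / (β + (p : ℚ) ^ r + i) - 1) < 1 := by
  have hq : padicNorm p ((p : ℚ) ^ r) = ((p : ℚ) ^ r)⁻¹ := norm_q p r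
  have hlt : ((p : ℚ) ^ r)⁻¹ < padicNorm p (β + (p : ℚ) ^ r + i) := by
    by_contra hcon
    push Not at hcon
    apply hbi
    apply eq_of_norm p r i b hi hb
    have e : (i : ℚ) - b = (β + (p : ℚ) ^ r + i) - ((p : ℚ) ^ r + (β + b)) := by ring
    rw [e]
    refine padicNorm.sub.trans (max_le hcon (padicNorm.nonarchimedean.trans (max_le hq.le h)))
  have hpos : 0 < padicNorm p (β + (p : ℚ) ^ r + i) :=
    lt_of_le_of_lt (by positivity) hlt
  have hne : β + (p : ℚ) ^ r + i ≠ 0 := by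
    intro h0
    rw [h0] at hpos
    simp at hpos
  have e : (β + i) / (β + (p : ℚ) ^ r + i) - 1 = -((p : ℚ) ^ r / (β + (p : ℚ) ^ r + i)) := by
    field_simp
    ring
  rw [e, padicNorm.neg, padicNorm.div, hq, div_lt_one hpos]
  exact hlt

end helpers

theorem stmt8 (c d s : ℕ) (hc1 : 1 ≤ c) (hcd : c ≤ d) (hs1 : 1 ≤ s) (hsd : s ≤ d)
    (hd : 2 ≤ d) (hgcd : Nat.gcd (c * s) d = 1)
    (p : ℕ) (hp : p.Prime) (hp5 : 5 ≤ p) (hps : p ≡ s [MOD d])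
    (α : ℚ) (hα : α = (c : ℚ) / d)
    (r : ℕ) (hr : 1 ≤ r)
    (hnd : ¬ ratCongr p 1 (dashIter p r (1/2 + α) * (1/2 + dashIter p r α)) 0)
    (a : ℕ) (ha : a = res (p ^ r) (-α))
    (l : ℕ) (hl : l < a) :
    ((a < (p ^ r + 1) / 2 ∨ ((p ^ r + 1) / 2 ≤ a ∧ l < a - (p ^ r - 1) / 2)) →
      ratCongr p 1 (poch (1/2 + α) l / poch (1/2 + α + (p : ℚ) ^ r) l) 1) ∧
    (((p ^ r + 1) / 2 ≤ a ∧ a - (p ^ r - 1) / 2 ≤ l) →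
      ratCongr p 1 (poch (1/2 + α) l / poch (1/2 + α + (p : ℚ) ^ r) l)
        ((2 * dashIter p r α - 1) / (2 * dashIter p r α + 1))) := by
  have : Fact p.Prime := ⟨hp⟩
  have hpd : Nat.Coprime p d := by
    have h1 : Nat.gcd p d = Nat.gcd s d := by
      have := hps.gcd_eq
      simpa using this
    have h2 : Nat.Coprime s d := Nat.Coprime.coprime_mul_left hgcd
    unfold Nat.Coprime
    rw [h1]; exact h2
  have hdn : padicNorm p (d : ℚ) = 1 :=
    (padicNorm.nat_eq_one_iff _).2 ((Nat.Prime.coprime_iff_not_dvd hp).1 hpd)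
  have h2n : padicNorm p (2 : ℚ) = 1 := by
    have := (padicNorm.nat_eq_one_iff (p := p) 2).2
      (fun h => by have := Nat.le_of_dvd (by norm_num) h; omega)
    exact_mod_cast this
  have hhalf : padicNorm p (1 / 2 : ℚ) = 1 := by
    rw [padicNorm.div, h2n]; simp
  have hαn : padicNorm p α ≤ 1 := by
    rw [hα, padicNorm.div, hdn, div_one]
    exact padicNorm.of_nat c
  have hβn : padicNorm p (1 / 2 + α) ≤ 1 :=
    padicNorm.nonarchimedean.trans (max_le hhalf.le hαn)
  obtain ⟨hAn, m, hm, hmA⟩ := dashIter_spec p r α hαn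
  obtain ⟨hBn, -⟩ := dashIter_spec p r (1 / 2 + α) hβn
  set A := dashIter p r α with hA
  set B := dashIter p r (1 / 2 + α) with hB
  have hq : padicNorm p ((p : ℚ) ^ r) = ((p : ℚ) ^ r)⁻¹ := norm_q p r
  have hqpos : (0 : ℚ) < (p : ℚ) ^ r := by
    have : (0 : ℚ) < p := by exact_mod_cast hp.pos
    positivity
  have ha_lt : a < p ^ r := ha ▸ res_lt p r _
  have hma : m = a := by
    apply eq_of_norm p r m a hm ha_lt
    have h1 := res_spec p r (-α) (by simpa using hαn)
    rw [← ha] at h1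
    have e : (m : ℚ) - a = (p : ℚ) ^ r * A + (-α - a) := by rw [← hmA]; ring
    rw [e]
    refine padicNorm.nonarchimedean.trans (max_le ?_ h1)
    rw [padicNorm.mul, hq]
    exact mul_le_of_le_one_right (by positivity) hAn
  subst hma
  obtain ⟨k, hk⟩ : Odd (p ^ r) := (hp.odd_of_ne_two (by omega)).pow
  have hk' : (p : ℚ) ^ r = 2 * k + 1 := by exact_mod_cast hk
  have hden : padicNorm p (A + 1 / 2) = 1 := by
    have h0 : ¬ padicNorm p (B * (1 / 2 + A) - 0) < 1 := fun h =>
      hnd ((ratCongr_one_iff p _ _).2 h)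
    rw [sub_zero, padicNorm.mul, not_lt, add_comm (1 / 2 : ℚ) A] at h0
    have h1 : padicNorm p (A + 1 / 2) ≤ 1 :=
      padicNorm.nonarchimedean.trans (max_le hAn hhalf.le)
    have h2 := mul_le_of_le_one_left (padicNorm.nonneg (p := p) (A + 1 / 2)) hBn
    exact le_antisymm h1 (h0.trans h2)
  have hpoch : poch (1 / 2 + α) l / poch (1 / 2 + α + (p : ℚ) ^ r) l =
      ∏ i ∈ Finset.range l, ((1 / 2 + α + i) / (1 / 2 + α + (p : ℚ) ^ r + i)) := by
    unfold poch
    rw [Finset.prod_div_distrib]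
  rw [ratCongr_one_iff, ratCongr_one_iff, hpoch]
  have caseB : ∀ b : ℕ, m = b + k + 1 →
      1 / 2 + α + b = (p : ℚ) ^ r * (A - 1 / 2) ∧
      padicNorm p (1 / 2 + α + b) ≤ ((p : ℚ) ^ r)⁻¹ := by
    intro b hb
    have e : 1 / 2 + α + b = (p : ℚ) ^ r * (A - 1 / 2) := by
      have hb' : (m : ℚ) = b + k + 1 := by exact_mod_cast hb
      linear_combination hmA - hb' + (1 / 2) * hk'
    refine ⟨e, ?_⟩
    rw [e, padicNorm.mul, hq]
    exact mul_le_of_le_one_right (by positivity)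
      (padicNorm.sub.trans (max_le hAn hhalf.le))
  refine ⟨?_, ?_⟩
  · intro h
    apply norm_prod_sub_one
    intro i hi
    have hil := Finset.mem_range.1 hi
    rcases h with h | ⟨h1, h2⟩
    · apply term_congr p r _ (m + k) i (by omega) (by omega) (by omega)
      have e : 1 / 2 + α + ((m + k : ℕ) : ℚ) = (p : ℚ) ^ r * (A + 1 / 2) := by
        push_cast
        linear_combination hmA - (1 / 2) * hk'
      rw [e, padicNorm.mul, hq, hden, mul_one]
    · obtain ⟨b, hb⟩ : ∃ b, m = b + k + 1 := ⟨m - k - 1, by omega⟩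
      exact term_congr p r _ b i (by omega) (by omega) (by omega) (caseB b hb).2
  · rintro ⟨h1, h2⟩
    obtain ⟨b, hb⟩ : ∃ b, m = b + k + 1 := ⟨m - k - 1, by omega⟩
    obtain ⟨e, hbn⟩ := caseB b hb
    have hbl : b ∈ Finset.range l := Finset.mem_range.2 (by omega)
    rw [← Finset.mul_prod_erase _ _ hbl]
    have hne : A + 1 / 2 ≠ 0 := by
      intro h0
      rw [h0] at hden
      simp at hden
    have hne2 : 2 * A + 1 ≠ 0 := by
      intro h0
      apply hne
      linear_combination h0 / 2
    have hT : (1 / 2 + α + b) / (1 / 2 + α + (p : ℚ) ^ r + b) = (A - 1 / 2) / (A + 1 / 2) := by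
      have e2 : 1 / 2 + α + (p : ℚ) ^ r + b = (p : ℚ) ^ r * (A + 1 / 2) := by
        linear_combination e
      rw [e, e2, mul_div_mul_left _ _ hqpos.ne']
    have hT2 : (2 * A - 1) / (2 * A + 1) = (A - 1 / 2) / (A + 1 / 2) := by
      rw [div_eq_div_iff hne2 hne]
      ring
    rw [hT, hT2, ← mul_sub_one, padicNorm.mul, padicNorm.div, hden, div_one]
    refine lt_of_le_of_lt (mul_le_of_le_one_left (padicNorm.nonneg _)
      (padicNorm.sub.trans (max_le hAn hhalf.le))) ?_
    apply norm_prod_sub_one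
    intro i hi
    have hi' := Finset.mem_erase.1 hi
    have hil := Finset.mem_range.1 hi'.2
    exact term_congr p r _ b i (by omega) (by omega) hi'.1 hbn
end
end

section
/- For any prime p ≥ 5 and any positive integer r, both p^{2r} H^{(2)}_{p^r−1} ≡ 0 (mod p^3) and p^{2r} H^{(2)}_{(p^r−1)/2} ≡ 0 (mod p^3) hold. -/
noncomputable section

lemma H2_succ (m : ℕ) : H2 (m + 1) = H2 m + 1 / ((m + 1 : ℕ) : ℚ) ^ 2 := by
  unfold H2
  rw [Finset.sum_Icc_succ_top (by omega)]

lemma H2_split (p : ℕ) [hp : Fact p.Prime] (m : ℕ) :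
    padicNorm p (H2 m - H2 (m / p) / (p : ℚ) ^ 2) ≤ 1 := by
  induction m with
  | zero => simp [H2]
  | succ m ih =>
    have hp0 : (p : ℚ) ≠ 0 := by exact_mod_cast hp.out.ne_zero
    rw [Nat.succ_div, H2_succ]
    split_ifs with h
    · have h2 : p * (m / p + 1) = m + 1 := by
        have := @Nat.succ_div m p
        rw [if_pos h] at this
        rw [← this]
        exact Nat.mul_div_cancel' h
      rw [H2_succ, ← h2]
      have h3 : ((m / p + 1 : ℕ) : ℚ) ≠ 0 := by positivity
      have : H2 m + 1 / ((p * (m / p + 1) : ℕ) : ℚ) ^ 2 -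
          (H2 (m / p) + 1 / ((m / p + 1 : ℕ) : ℚ) ^ 2) / (p : ℚ) ^ 2 =
          H2 m - H2 (m / p) / (p : ℚ) ^ 2 := by
        rw [Nat.cast_mul]
        field_simp
        ring
      rw [this]; exact ih
    · have h1 : padicNorm p ((m + 1 : ℕ) : ℚ) = 1 := (padicNorm.nat_eq_one_iff (m + 1)).2 h
      have : H2 m + 1 / ((m + 1 : ℕ) : ℚ) ^ 2 - H2 (m / p + 0) / (p : ℚ) ^ 2 =
        (H2 m - H2 (m / p) / (p : ℚ) ^ 2) + 1 / ((m + 1 : ℕ) : ℚ) ^ 2 := by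
        rw [add_zero]; ring
      rw [this]
      refine le_trans padicNorm.nonarchimedean (max_le ih ?_)
      rw [padicNorm.div, pow_two, padicNorm.mul, h1]
      simp

lemma H2_step (p : ℕ) [hp : Fact p.Prime] (m r : ℕ) (hr : 1 ≤ r)
    (h : padicNorm p ((p : ℚ) ^ (2 * r) * H2 (m / p)) ≤ (p : ℚ) ^ (-3 : ℤ)) :
    padicNorm p ((p : ℚ) ^ (2 * (r + 1)) * H2 m) ≤ (p : ℚ) ^ (-3 : ℤ) := by
  have hp0 : (p : ℚ) ≠ 0 := by exact_mod_cast hp.out.ne_zero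
  have hp1 : (1 : ℚ) ≤ p := by exact_mod_cast hp.out.one_lt.le
  have : (p : ℚ) ^ (2 * (r + 1)) * H2 m =
      (p : ℚ) ^ (2 * (r + 1)) * (H2 m - H2 (m / p) / (p : ℚ) ^ 2) +
      (p : ℚ) ^ (2 * r) * H2 (m / p) := by
    rw [mul_add, pow_add]
    field_simp
    ring
  rw [this]
  refine le_trans padicNorm.nonarchimedean (max_le ?_ h)
  rw [padicNorm.mul]
  have h1 : padicNorm p ((p : ℚ) ^ (2 * (r + 1))) ≤ (p : ℚ) ^ (-3 : ℤ) := by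
    have := (padicNorm.dvd_iff_norm_le (p := p) (n := 3) (z := (p : ℤ) ^ (2 * (r + 1)))).1
      (by push_cast; exact pow_dvd_pow _ (by omega))
    simpa using this
  calc _ ≤ (p : ℚ) ^ (-3 : ℤ) * 1 :=
        mul_le_mul h1 (H2_split p m) (padicNorm.nonneg _) (by positivity)
    _ = _ := mul_one _

lemma H2_base (p : ℕ) [hp : Fact p.Prime] (m : ℕ) (hm : m < p)
    (h : ∑ k ∈ Finset.Icc 1 m, (((k : ZMod p))⁻¹) ^ 2 = 0) :
    padicNorm p ((p : ℚ) ^ (2 * 1) * H2 m) ≤ (p : ℚ) ^ (-3 : ℤ) := by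
  have hp0 : (p : ℚ) ≠ 0 := by exact_mod_cast hp.out.ne_zero
  set N : ℕ := ∑ k ∈ Finset.Icc 1 m, (m.factorial / k) ^ 2 with hN
  have hdvd : ∀ k ∈ Finset.Icc 1 m, k ∣ m.factorial := fun k hk => by
    rw [Finset.mem_Icc] at hk
    exact Nat.dvd_factorial hk.1 hk.2
  have hNQ : (N : ℚ) = (m.factorial : ℚ) ^ 2 * H2 m := by
    rw [hN, H2, Finset.mul_sum]
    push_cast
    refine Finset.sum_congr rfl fun k hk => ?_
    have hk0 : (k : ℚ) ≠ 0 := by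
      rw [Finset.mem_Icc] at hk
      exact_mod_cast (by omega : k ≠ 0)
    rw [Nat.cast_div (hdvd k hk) hk0]
    field_simp
  have hNZ : (N : ZMod p) = 0 := by
    have : (N : ZMod p) = (m.factorial : ZMod p) ^ 2 *
        ∑ k ∈ Finset.Icc 1 m, (((k : ZMod p))⁻¹) ^ 2 := by
      rw [hN, Finset.mul_sum]
      push_cast
      refine Finset.sum_congr rfl fun k hk => ?_
      have hk0 : (k : ZMod p) ≠ 0 := by
        rw [Finset.mem_Icc] at hk
        rw [Ne, ZMod.natCast_eq_zero_iff]
        exact fun hd => by have := Nat.le_of_dvd (by omega) hd; omega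
      rw [Nat.cast_div (hdvd k hk) hk0]
      field_simp
    rw [this, h, mul_zero]
  have hpN : p ∣ N := (ZMod.natCast_eq_zero_iff _ _).1 hNZ
  have hf : padicNorm p (m.factorial : ℚ) = 1 := by
    rw [padicNorm.nat_eq_one_iff, hp.out.dvd_factorial]; omega
  have hH : padicNorm p ((p : ℚ) ^ (2 * 1) * H2 m) = padicNorm p ((p : ℚ) ^ (2 * 1) * N) := by
    rw [hNQ, pow_two (m.factorial : ℚ)]
    simp only [padicNorm.mul, hf, one_mul]
  rw [hH]
  have := (padicNorm.dvd_iff_norm_le (p := p) (n := 3) (z := (p : ℤ) ^ (2 * 1) * N)).1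
      (by
        push_cast
        rw [show 3 = 2 * 1 + 1 from rfl, pow_succ]
        exact mul_dvd_mul_left _ (by exact_mod_cast hpN))
  simpa using this

lemma sum_full (p : ℕ) [hp : Fact p.Prime] (hp5 : 5 ≤ p) :
    ∑ k ∈ Finset.Icc 1 (p - 1), (((k : ZMod p))⁻¹) ^ 2 = 0 := by
  have h1 : ∑ x : ZMod p, x ^ 2 = 0 := by
    apply FiniteField.sum_pow_lt_card_sub_one
    rw [ZMod.card]; omega
  have h2 : ∑ x : ZMod p, (x⁻¹) ^ 2 = ∑ x : ZMod p, x ^ 2 :=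
    Equiv.sum_comp (Equiv.inv (ZMod p)) (fun x => x ^ 2)
  have h3 : ∑ k ∈ Finset.range p, (((k : ZMod p))⁻¹) ^ 2 = ∑ x : ZMod p, (x⁻¹) ^ 2 := by
    refine Finset.sum_bij' (fun k _ => (k : ZMod p)) (fun x _ => x.val) ?_ ?_ ?_ ?_ ?_
    · simp
    · intro x _; simpa using ZMod.val_lt x
    · intro k hk; exact ZMod.val_cast_of_lt (by simpa using hk)
    · intro x _; simp
    · simp
  rw [← h1, ← h2, ← h3]
  refine Finset.sum_subset ?_ ?_
  · intro k hk; simp at hk ⊢; omega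
  · intro k hk hk'
    simp at hk hk'
    have : k = 0 := by by_contra hne; have := hk' (by omega); omega
    simp [this]

lemma sum_half (p : ℕ) [hp : Fact p.Prime] (hp5 : 5 ≤ p) :
    ∑ k ∈ Finset.Icc 1 ((p - 1) / 2), (((k : ZMod p))⁻¹) ^ 2 = 0 := by
  have hodd : p % 2 = 1 := by
    rcases hp.out.eq_two_or_odd with h | h <;> omega
  have h := sum_full p hp5
  have hU : Finset.Icc 1 (p - 1) =
      Finset.Icc 1 ((p - 1) / 2) ∪ Finset.Icc ((p - 1) / 2 + 1) (p - 1) := by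
    ext k; simp; omega
  have hD : Disjoint (Finset.Icc 1 ((p - 1) / 2)) (Finset.Icc ((p - 1) / 2 + 1) (p - 1)) := by
    rw [Finset.disjoint_left]; intro k; simp; omega
  rw [hU, Finset.sum_union hD] at h
  have hR : ∑ k ∈ Finset.Icc ((p - 1) / 2 + 1) (p - 1), (((k : ZMod p))⁻¹) ^ 2 =
      ∑ k ∈ Finset.Icc 1 ((p - 1) / 2), (((k : ZMod p))⁻¹) ^ 2 := by
    refine Finset.sum_bij' (fun k _ => p - k) (fun k _ => p - k) ?_ ?_ ?_ ?_ ?_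
    · intro k hk; simp at hk ⊢; omega
    · intro k hk; simp at hk ⊢; omega
    · intro k hk; simp at hk ⊢; omega
    · intro k hk; simp at hk ⊢; omega
    · intro k hk
      simp only [Finset.mem_Icc] at hk
      rw [Nat.cast_sub (by omega)]
      simp [inv_neg]
  rw [hR, ← two_mul] at h
  have h2 : (2 : ZMod p) ≠ 0 := by
    have : ((2 : ℕ) : ZMod p) ≠ 0 := by
      rw [Ne, ZMod.natCast_eq_zero_iff]
      exact fun hd => by have := Nat.le_of_dvd (by omega) hd; omega
    exact_mod_cast this
  exact (mul_eq_zero.1 h).resolve_left h2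

lemma ratCongr_of_norm (p : ℕ) [hp : Fact p.Prime] (x : ℚ)
    (h : padicNorm p x ≤ (p : ℚ) ^ (-3 : ℤ)) : ratCongr p 3 x 0 := by
  by_cases hx : x = 0
  · exact Or.inl hx
  · right
    rw [padicNorm.eq_zpow_of_nonzero hx,
      zpow_le_zpow_iff_right₀ (by exact_mod_cast hp.out.one_lt)] at h
    rw [sub_zero]; omega

theorem stmt9 (p : ℕ) (hp : p.Prime) (hp5 : 5 ≤ p) (r : ℕ) (hr : 1 ≤ r) :
    ratCongr p 3 ((p : ℚ) ^ (2 * r) * H2 (p ^ r - 1)) 0 ∧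
    ratCongr p 3 ((p : ℚ) ^ (2 * r) * H2 ((p ^ r - 1) / 2)) 0 := by
  haveI : Fact p.Prime := ⟨hp⟩
  have hdiv : ∀ r : ℕ, (p ^ (r + 1) - 1) / p = p ^ r - 1 := by
    intro r
    have h1 : 1 ≤ p ^ r := Nat.one_le_pow _ _ hp.pos
    obtain ⟨a, ha⟩ : ∃ a, p ^ r = a + 1 := ⟨p ^ r - 1, by omega⟩
    rw [pow_succ, ha]
    have : (a + 1) * p - 1 = (p - 1) + p * a := by
      have : (a + 1) * p = p + p * a := by ring
      omega
    rw [this, Nat.add_mul_div_left _ _ hp.pos, Nat.div_eq_of_lt (by omega)]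
    omega
  constructor <;> apply ratCongr_of_norm
  · induction r, hr using Nat.le_induction with
    | base => rw [pow_one]; exact H2_base p _ (by omega) (sum_full p hp5)
    | succ r hr ih =>
      apply H2_step p _ r hr
      rw [hdiv]; exact ih
  · induction r, hr using Nat.le_induction with
    | base => rw [pow_one]; exact H2_base p _ (by omega) (sum_half p hp5)
    | succ r hr ih =>
      apply H2_step p _ r hr
      rw [Nat.div_div_eq_div_mul, mul_comm 2 p, ← Nat.div_div_eq_div_mul, hdiv]; exact ih
end
end

section
/- Let c, d, s be positive integers with d ≥ 2, 1 ≤ c, s ≤ d and gcd(cs, d) = 1, let p ≥ 5 be a prime with p ≡ s (mod d), set α = c/d, let r be a positive integer, and let a = ⟨−α⟩_{p^r}. Then p^{2r} ∑_{l=1}^{a} 1/(α + a − l)^2 ≡ p^2 H^{(2)}_{α^{*_r} p − α^{*_{r−1}}} (mod p^3). -/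
noncomputable section

lemma res_spec_s10 (m d e : ℕ) (hm : 0 < m) (hd : 0 < d) (hmd : Nat.Coprime m d) :
    res m (-((e : ℚ) / d)) < m ∧ m ∣ e + res m (-((e : ℚ) / d)) * d := by
  haveI : NeZero m := ⟨hm.ne'⟩
  refine ⟨ZMod.val_lt _, ?_⟩
  set x : ℚ := -((e : ℚ) / d) with hx
  have hdq : (d : ℚ) ≠ 0 := by positivity
  have hxq : x.num * (d : ℤ) = -(e : ℤ) * (x.den : ℤ) := by
    have h1 : (x.num : ℚ) = x * x.den := (Rat.mul_den_eq_num x).symm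
    have h2 : (x.num : ℚ) * d = -(e : ℚ) * x.den := by
      rw [h1, hx]; field_simp
    exact_mod_cast h2
  have hdvd : x.den ∣ d := by
    have h : (x.den : ℤ) ∣ x.num * (d : ℤ) := ⟨-(e : ℤ), by rw [hxq]; ring⟩
    have hc : IsCoprime (x.den : ℤ) x.num := by
      have := x.reduced
      rw [Int.isCoprime_iff_nat_coprime]
      simpa using this.symm
    exact_mod_cast hc.dvd_of_dvd_mul_left h
  have hcop : Nat.Coprime x.den m := (hmd.symm).coprime_dvd_left hdvd
  have hinv : (x.den : ZMod m) * (x.den : ZMod m)⁻¹ = 1 := ZMod.coe_mul_inv_eq_one _ hcop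
  rw [← ZMod.natCast_eq_zero_iff]
  push_cast
  rw [res, ZMod.natCast_zmod_val]
  have hz : (x.num : ZMod m) * (d : ZMod m) = -(e : ZMod m) * (x.den : ZMod m) := by
    have := congrArg (Int.cast : ℤ → ZMod m) hxq
    push_cast at this
    exact this
  linear_combination (x.den : ZMod m)⁻¹ * hz - (e : ZMod m) * hinv

lemma dash_spec (p d e : ℕ) (hp : 0 < p) (hd : 0 < d) (hpd : Nat.Coprime p d)
    (he1 : 1 ≤ e) (hed : e ≤ d) :
    ∃ t e' : ℕ, t < p ∧ 1 ≤ e' ∧ e' ≤ d ∧ e + t * d = p * e' ∧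
      dash p ((e : ℚ) / d) = (e' : ℚ) / d := by
  obtain ⟨h1, e', h2⟩ := res_spec_s10 p d e hp hd hpd
  refine ⟨_, e', h1, ?_, ?_, h2, ?_⟩
  · rcases Nat.eq_zero_or_pos e' with h | h
    · subst h; simp at h2; omega
    · exact h
  · have h3 : (res p (-((e : ℚ) / d)) + 1) * d ≤ p * d := Nat.mul_le_mul_right _ h1
    have : p * e' ≤ p * d := by rw [← h2]; linarith
    exact Nat.le_of_mul_le_mul_left this hp
  · have h2' : (e : ℚ) + (res p (-((e : ℚ) / d)) : ℚ) * d = p * e' := by exact_mod_cast h2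
    have hdq : (d : ℚ) ≠ 0 := by positivity
    have hpq : (p : ℚ) ≠ 0 := by positivity
    rw [dash]
    field_simp
    linear_combination h2'

lemma iter_spec (p d c : ℕ) (hp : 0 < p) (hd : 0 < d) (hpd : Nat.Coprime p d)
    (hc1 : 1 ≤ c) (hcd : c ≤ d) (k : ℕ) :
    ∃ e A : ℕ, 1 ≤ e ∧ e ≤ d ∧ A < p ^ k ∧ p ^ k * e = c + A * d ∧
      dashIter p k ((c : ℚ) / d) = (e : ℚ) / d := by
  induction k with
  | zero => exact ⟨c, 0, hc1, hcd, by simp, by simp, by simp [dashIter]⟩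
  | succ k ih =>
    obtain ⟨e, A, h1, h2, h3, h4, h5⟩ := ih
    obtain ⟨t, e', g1, g2, g3, g4, g5⟩ := dash_spec p d e hp hd hpd h1 h2
    refine ⟨e', A + p ^ k * t, g2, g3, ?_, ?_, ?_⟩
    · have : p ^ k * (t + 1) ≤ p ^ k * p := Nat.mul_le_mul_left _ g1
      rw [pow_succ]; linarith
    · rw [pow_succ]
      calc p ^ k * p * e' = p ^ k * (p * e') := by ring
        _ = p ^ k * e + p ^ k * t * d := by rw [← g4]; ring
        _ = _ := by rw [h4]; ring
    · rw [dashIter] at h5 ⊢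
      rw [Function.iterate_succ_apply', h5, g5]

lemma norm_le (p : ℕ) [Fact p.Prime] (N D : ℤ) (hD : ¬ (p : ℤ) ∣ D) :
    padicNorm p ((p : ℚ) ^ 3 * N / D) ≤ ((p : ℚ) ^ 3)⁻¹ := by
  rw [padicNorm.div, padicNorm.mul]
  have h1 : padicNorm p (D : ℚ) = 1 := by
    exact_mod_cast (padicNorm.int_eq_one_iff D).2 hD
  have h2 : padicNorm p (N : ℚ) ≤ 1 := padicNorm.of_int N
  have h3 : padicNorm p ((p : ℚ) ^ 3) = ((p : ℚ) ^ 3)⁻¹ := by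
    have := padicNorm.padicNorm_p_of_prime (p := p)
    rw [pow_succ, pow_succ, pow_one, padicNorm.mul, padicNorm.mul, this]
    simp only [mul_inv]
  rw [h1, h3, div_one]
  have : (0 : ℚ) ≤ ((p : ℚ) ^ 3)⁻¹ := by positivity
  nlinarith

lemma not_dvd_sq {p : ℕ} (hp : p.Prime) (d m : ℤ) (x : ℤ)
    (hd : ¬ (p : ℤ) ∣ d) (hm : ¬ (p : ℤ) ∣ m) (hx : (p : ℤ) ∣ x) :
    ¬ (p : ℤ) ∣ (x - m * d) ^ 2 := by
  have hpp : Prime (p : ℤ) := Nat.prime_iff_prime_int.1 hp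
  intro h
  have h1 := hpp.dvd_of_dvd_pow h
  have h2 : (p : ℤ) ∣ m * d := (dvd_sub_right hx).1 h1
  rcases hpp.dvd_or_dvd h2 with h | h
  · exact hm h
  · exact hd h

lemma term_bound (p d e n k l : ℕ) (hp : p.Prime) (hd : ¬ p ∣ d) (hd0 : 0 < d)
    (hn : n < p) (hl1 : 1 ≤ l) (hl : l < p ^ k * (n + 1)) :
    padicNorm p ((p : ℚ) ^ (2 * (k + 1)) * (1 / ((p : ℚ) ^ (k + 1) * ((e : ℚ) / d) - l) ^ 2)
      - if p ^ k ∣ l then (p : ℚ) ^ (2 * (k + 1)) / (l : ℚ) ^ 2 else 0) ≤ ((p : ℚ) ^ 3)⁻¹ := by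
  haveI : Fact p.Prime := ⟨hp⟩
  have hpp : Prime (p : ℤ) := Nat.prime_iff_prime_int.1 hp
  have hdz : ¬ (p : ℤ) ∣ (d : ℤ) := by exact_mod_cast hd
  have hpq : (p : ℚ) ≠ 0 := by exact_mod_cast hp.ne_zero
  have hdq : (d : ℚ) ≠ 0 := by positivity
  split_ifs with hdiv
  · obtain ⟨j, rfl⟩ := hdiv
    have hj : j < n + 1 := Nat.lt_of_mul_lt_mul_left hl
    have hj1 : 1 ≤ j := by
      rcases Nat.eq_zero_or_pos j with h | h
      · subst h; simp at hl1
      · exact h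
    have hjp : ¬ p ∣ j := fun h => by have := Nat.le_of_dvd hj1 h; omega
    have hjz : ¬ (p : ℤ) ∣ (j : ℤ) := by exact_mod_cast hjp
    have hD := not_dvd_sq hp d j ((p : ℤ) * e) hdz hjz (dvd_mul_right _ _)
    have hD2 : ¬ (p : ℤ) ∣ (((p : ℤ) * e - j * d) ^ 2 * j ^ 2) := by
      intro h
      rcases hpp.dvd_or_dvd h with h | h
      · exact hD h
      · exact hjz (hpp.dvd_of_dvd_pow h)
    have hne : ((p : ℚ) * e - j * d) ≠ 0 := by
      intro h
      apply hD
      have : ((p : ℤ) * e - j * d) = 0 := by exact_mod_cast h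
      rw [this]; simp
    have hjq : (j : ℚ) ≠ 0 := by positivity
    convert norm_le p (e * (2 * j * d - p * e)) _ hD2 using 2
    have e1 : (p : ℚ) ^ (k + 1) * ((e : ℚ) / d) - ((p ^ k * j : ℕ) : ℚ)
        = (p : ℚ) ^ k * (p * e - j * d) / d := by
      push_cast; field_simp; ring
    rw [e1]
    push_cast
    field_simp
    ring
  · obtain ⟨i, m, hm, rfl⟩ := Nat.exists_eq_pow_mul_and_not_dvd (n := l) (by omega) p hp.ne_one
    have hik : i < k := by
      by_contra h
      exact hdiv (Dvd.dvd.mul_right (pow_dvd_pow p (not_lt.1 h)) m)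
    obtain ⟨h, rfl⟩ : ∃ h, k = i + 1 + h := ⟨k - (i + 1), by omega⟩
    have hmz : ¬ (p : ℤ) ∣ (m : ℤ) := by exact_mod_cast hm
    have hD := not_dvd_sq hp d m ((p : ℤ) ^ (h + 2) * e) hdz hmz
      (Dvd.dvd.mul_right (dvd_pow_self _ (by omega)) _)
    have hne : ((p : ℚ) ^ (h + 2) * e - m * d) ≠ 0 := by
      intro h0
      apply hD
      have : ((p : ℤ) ^ (h + 2) * e - m * d) = 0 := by exact_mod_cast h0
      rw [this]; simp
    convert norm_le p (p ^ (2 * h + 1) * d ^ 2) _ hD using 2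
    have e1 : (p : ℚ) ^ (i + 1 + h + 1) * ((e : ℚ) / d) - ((p ^ i * m : ℕ) : ℚ)
        = (p : ℚ) ^ i * (p ^ (h + 2) * e - m * d) / d := by
      push_cast; field_simp; ring
    rw [e1]
    push_cast
    field_simp
    ring

lemma sum_multiples (p k n A : ℕ) (hp : 0 < p) (hA : A < p ^ k) :
    ∑ l ∈ Finset.Icc 1 (A + p ^ k * n),
      (if p ^ k ∣ l then (p : ℚ) ^ (2 * (k + 1)) / (l : ℚ) ^ 2 else 0) = (p : ℚ) ^ 2 * H2 n := by
  rw [← Finset.sum_filter, H2, Finset.mul_sum]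
  symm
  have hpk : 0 < p ^ k := by positivity
  have hpq : (p : ℚ) ≠ 0 := by positivity
  refine Finset.sum_bij (fun j _ => p ^ k * j) ?_ ?_ ?_ ?_
  · intro j hj
    simp only [Finset.mem_Icc, Finset.mem_filter] at hj ⊢
    have := Nat.mul_le_mul_left (p ^ k) hj.2
    have h2 : 0 < p ^ k * j := Nat.mul_pos hpk hj.1
    exact ⟨⟨h2, by omega⟩, dvd_mul_right _ _⟩
  · intro j _ j' _ h
    exact Nat.eq_of_mul_eq_mul_left hpk h
  · intro l hl
    simp only [Finset.mem_Icc, Finset.mem_filter] at hl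
    obtain ⟨⟨h1, h2⟩, j, rfl⟩ := hl
    refine ⟨j, ?_, rfl⟩
    rw [Finset.mem_Icc]
    constructor
    · rcases Nat.eq_zero_or_pos j with h | h
      · subst h; simp at h1
      · exact h
    · have : p ^ k * j < p ^ k * (n + 1) := by linarith
      have := Nat.lt_of_mul_lt_mul_left this
      omega
  · intro j hj
    rw [Finset.mem_Icc] at hj
    have : (j : ℚ) ≠ 0 := by have := hj.1; positivity
    push_cast
    field_simp
    ring

theorem stmt10 (c d s : ℕ) (hc1 : 1 ≤ c) (hcd : c ≤ d) (hs1 : 1 ≤ s) (hsd : s ≤ d)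
    (hd : 2 ≤ d) (hgcd : Nat.gcd (c * s) d = 1)
    (p : ℕ) (hp : p.Prime) (hp5 : 5 ≤ p) (hps : p ≡ s [MOD d])
    (α : ℚ) (hα : α = (c : ℚ) / d)
    (r : ℕ) (hr : 1 ≤ r)
    (a : ℕ) (ha : a = res (p ^ r) (-α))
    (n : ℕ) (hn : (n : ℚ) = dashIter p r α * p - dashIter p (r - 1) α) :
    ratCongr p 3
      ((p : ℚ) ^ (2 * r) * ∑ l ∈ Finset.Icc 1 a, 1 / (α + (a : ℚ) - (l : ℚ)) ^ 2)
      ((p : ℚ) ^ 2 * H2 n) := by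
  haveI : Fact p.Prime := ⟨hp⟩
  have hd0 : 0 < d := by omega
  have hsd' : Nat.Coprime s d := Nat.Coprime.coprime_mul_left hgcd
  have hpd : Nat.Coprime p d := by
    have := hps.gcd_eq
    rw [Nat.Coprime, this]; exact hsd'
  have hpdv : ¬ p ∣ d := (Nat.Prime.coprime_iff_not_dvd hp).1 hpd
  obtain ⟨k, rfl⟩ : ∃ k, r = k + 1 := ⟨r - 1, by omega⟩
  subst hα
  obtain ⟨e, A, h1, h2, h3, h4, h5⟩ := iter_spec p d c hp.pos hd0 hpd hc1 hcd k
  obtain ⟨t, e', g1, g2, g3, g4, g5⟩ := dash_spec p d e hp.pos hd0 hpd h1 h2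
  have hdq : (d : ℚ) ≠ 0 := by positivity
  have hit : dashIter p (k + 1) ((c : ℚ) / d) = (e' : ℚ) / d := by
    rw [dashIter] at h5 ⊢
    rw [Function.iterate_succ_apply', h5, g5]
  have hnt : n = t := by
    rw [hit, Nat.add_sub_cancel, h5] at hn
    have g4' : (e : ℚ) + t * d = p * e' := by exact_mod_cast g4
    have : (n : ℚ) = t := by
      rw [hn]; field_simp; linear_combination -g4'
    exact_mod_cast this
  subst hnt
  have hE : p ^ (k + 1) * e' = c + (A + p ^ k * n) * d := by
    rw [pow_succ]
    calc p ^ k * p * e' = p ^ k * (p * e') := by ring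
      _ = p ^ k * e + p ^ k * n * d := by rw [← g4]; ring
      _ = _ := by rw [h4]; ring
  have hlt : A + p ^ k * n < p ^ (k + 1) := by
    have : p ^ k * (n + 1) ≤ p ^ k * p := Nat.mul_le_mul_left _ g1
    rw [pow_succ]; linarith
  have haA : a = A + p ^ k * n := by
    have hcop : Nat.Coprime (p ^ (k + 1)) d := Nat.Coprime.pow_left _ hpd
    obtain ⟨q1, q2⟩ := res_spec_s10 (p ^ (k + 1)) d c (pow_pos hp.pos _) hd0 hcop
    rw [← ha] at q1 q2
    have q3 : p ^ (k + 1) ∣ c + (A + p ^ k * n) * d := ⟨e', hE.symm⟩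
    have q4 : c + a * d ≡ c + (A + p ^ k * n) * d [MOD p ^ (k + 1)] :=
      ((Nat.modEq_zero_iff_dvd).2 q2).trans ((Nat.modEq_zero_iff_dvd).2 q3).symm
    have q5 := Nat.ModEq.add_left_cancel' c q4
    have q6 := Nat.ModEq.cancel_right_of_coprime hcop q5
    exact q6.eq_of_lt_of_lt q1 hlt
  clear ha
  subst haA
  have hE' : (c : ℚ) / d + ((A + p ^ k * n : ℕ) : ℚ) = (p : ℚ) ^ (k + 1) * ((e' : ℚ) / d) := by
    have : (p : ℚ) ^ (k + 1) * e' = c + ((A + p ^ k * n : ℕ) : ℚ) * d := by exact_mod_cast hE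
    field_simp; linear_combination -this
  rw [ratCongr, or_iff_not_imp_left]
  intro hne
  have hsub := sub_ne_zero.2 hne
  have hnorm : padicNorm p ((p : ℚ) ^ (2 * (k + 1)) * ∑ l ∈ Finset.Icc 1 (A + p ^ k * n),
      1 / ((c : ℚ) / d + ((A + p ^ k * n : ℕ) : ℚ) - (l : ℚ)) ^ 2 - (p : ℚ) ^ 2 * H2 n)
      ≤ ((p : ℚ) ^ 3)⁻¹ := by
    rw [← sum_multiples p k n A hp.pos h3, Finset.mul_sum, ← Finset.sum_sub_distrib, hE']
    refine padicNorm.sum_le' ?_ (by positivity)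
    intro l hl
    rw [Finset.mem_Icc] at hl
    exact term_bound p d e' n k l hp hpdv hd0 g1 hl.1 (by linarith [hl.2])
  rw [padicNorm.eq_zpow_of_nonzero hsub] at hnorm
  have h3' : ((p : ℚ) ^ 3)⁻¹ = (p : ℚ) ^ (-3 : ℤ) := by
    rw [zpow_neg]; norm_cast
  rw [h3', zpow_le_zpow_iff_right₀ (by exact_mod_cast hp.one_lt)] at hnorm
  linarith
end
end

section
/- Let c, d, s be positive integers with d ≥ 2, 1 ≤ c, s ≤ d and gcd(cs, d) = 1, let p ≥ 5 be a prime with p ≡ s (mod d), set α = c/d, let r be a positive integer, and let a = ⟨−α⟩_{p^r}. Then p^{2r} ∑_{l=1}^{(p^r−1)/2} 1/(α + a − l)^2 ≡ 0 (mod p^3). -/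
noncomputable section

open Finset in
theorem aux_half (p : ℕ) [Fact p.Prime] (hp5 : 5 ≤ p) (h : ℕ) (hh : p = 2 * h + 1) :
    ∑ j ∈ Icc 1 h, (((j : ZMod p))⁻¹) ^ 2 = 0 := by
  have e1 : ∑ x : ZMod p, (x⁻¹) ^ 2 = 0 := by
    have := FiniteField.sum_pow_lt_card_sub_one (K := ZMod p) 2 (by rw [ZMod.card]; omega)
    rw [← this]
    exact Equiv.sum_comp (Equiv.inv (ZMod p)) (fun x => x ^ 2)
  have e2 : ∑ x : ZMod p, (x⁻¹) ^ 2 = ∑ j ∈ range p, (((j : ZMod p))⁻¹) ^ 2 := by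
    symm
    refine sum_bij (fun j _ => (j : ZMod p)) (by simp) ?_ ?_ (by simp)
    · intro a ha b hb hab
      rw [ZMod.natCast_eq_natCast_iff] at hab
      exact Nat.ModEq.eq_of_lt_of_lt hab (mem_range.1 ha) (mem_range.1 hb)
    · intro b _
      exact ⟨b.val, mem_range.2 (ZMod.val_lt b), by simp⟩
  have e3 : ∑ j ∈ range p, (((j : ZMod p))⁻¹) ^ 2
      = ∑ j ∈ Icc 1 h, (((j : ZMod p))⁻¹) ^ 2 + ∑ j ∈ Icc 1 h, (((j : ZMod p))⁻¹) ^ 2 := by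
    have s1 : ∑ j ∈ range p, (((j : ZMod p))⁻¹) ^ 2
        = ∑ j ∈ Icc 1 (2*h), (((j : ZMod p))⁻¹) ^ 2 := by
      symm
      apply sum_subset
      · intro x hx; simp at hx ⊢; omega
      · intro x hx hx2
        have : x = 0 := by simp at hx hx2; omega
        subst this; simp
    have s2 : Icc 1 (2*h) = Icc 1 h ∪ Icc (h+1) (2*h) := by
      ext x; simp; omega
    rw [s1, s2, sum_union (by
      rw [Finset.disjoint_left]; intro x hx hy; simp at hx hy; omega)]
    congr 1
    refine sum_bij (fun j _ => p - j) ?_ ?_ ?_ ?_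
    · intro j hj; simp at hj ⊢; omega
    · intro i hi j hj; simp at hi hj ⊢; omega
    · intro j hj; simp at hj; exact ⟨p - j, by simp; omega, by omega⟩
    · intro j hj
      simp at hj
      rw [Nat.cast_sub (by omega)]
      simp [inv_neg]
  have e4 : (2 : ZMod p) * ∑ j ∈ Icc 1 h, (((j : ZMod p))⁻¹) ^ 2 = 0 := by
    rw [two_mul, ← e3, ← e2, e1]
  rcases mul_eq_zero.1 e4 with h2 | h2
  · exfalso
    have : ((2 : ℕ) : ZMod p) = 0 := by exact_mod_cast h2
    rw [ZMod.natCast_eq_zero_iff] at this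
    have := Nat.le_of_dvd (by norm_num) this
    omega
  · exact h2

theorem aux_Z (p : ℕ) [Fact p.Prime] (k : ℕ) (t : ℤ_[p]) (l : ℕ) (hl : 1 ≤ l)
    (hlt : l < p ^ (k + 1)) :
    ∃ Z : ℤ_[p], Z * ((p : ℤ_[p]) ^ (k + 1) * t - l) = (p : ℤ_[p]) ^ k ∧
      PadicInt.toZMod Z = if p ^ k ∣ l then -((l / p ^ k : ℕ) : ZMod p)⁻¹ else 0 := by
  have hp : p.Prime := Fact.out
  obtain ⟨v, u, hu, rfl⟩ := Nat.exists_eq_pow_mul_and_not_dvd (n := l) (by omega) p hp.ne_one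
  have hv : v ≤ k := by
    by_contra hv
    have h1 : p ^ (k + 1) ∣ p ^ v * u := (pow_dvd_pow p (by omega)).mul_right u
    have := Nat.le_of_dvd (by omega) h1
    omega
  obtain ⟨e, rfl⟩ := Nat.exists_eq_add_of_le hv
  have hu0 : (u : ZMod p) ≠ 0 := by rwa [Ne, ZMod.natCast_eq_zero_iff]
  have hun : IsUnit ((p : ℤ_[p]) ^ (e + 1) * t - u) := by
    by_contra hn
    rw [← mem_nonunits_iff, ← IsLocalRing.mem_maximalIdeal, ← PadicInt.ker_toZMod,
      RingHom.mem_ker] at hn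
    simp at hn
    exact hu ((ZMod.natCast_eq_zero_iff u p).1 hn)
  obtain ⟨Y, hY⟩ := hun.exists_left_inv
  refine ⟨(p : ℤ_[p]) ^ e * Y, ?_, ?_⟩
  · push_cast
    linear_combination (p : ℤ_[p]) ^ (v + e) * hY
  · have hY2 := congrArg PadicInt.toZMod hY
    simp at hY2
    have hpp : 0 < p := hp.pos
    rcases Nat.eq_zero_or_pos e with he | he
    · subst he
      simp [Nat.mul_div_cancel_left u (pow_pos hpp v)]
      field_simp
      linear_combination -hY2
    · rw [if_neg]
      · simp [he.ne']
      · rw [pow_add, Nat.mul_dvd_mul_iff_left (pow_pos hpp v)]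
        intro hd
        exact hu ((dvd_pow_self p he.ne').trans hd)

open Finset in
theorem aux_sum (p : ℕ) [Fact p.Prime] (hp5 : 5 ≤ p) (q : ℕ) (hq : 0 < q) :
    ∑ l ∈ Icc 1 ((p * q - 1) / 2), (if q ∣ l then -((l / q : ℕ) : ZMod p)⁻¹ else 0) ^ 2 = 0 := by
  have hp : p.Prime := Fact.out
  obtain ⟨h, hh⟩ := hp.odd_of_ne_two (by omega)
  refine Eq.trans ?_ (aux_half p hp5 h hh)
  symm
  refine sum_of_injOn (fun j => q * j) ?_ ?_ ?_ ?_
  · intro i _ j _ hij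
    exact Nat.eq_of_mul_eq_mul_left hq hij
  · intro j hj
    simp at hj ⊢
    have h1 : 1 ≤ q * j := Nat.mul_pos hq hj.1
    have h2 : 2 * (q * j) + q ≤ p * q := by rw [hh]; nlinarith
    omega
  · intro l hl hn
    rw [if_neg]
    · simp
    · rintro ⟨j, rfl⟩
      apply hn
      simp at hl
      refine ⟨j, ?_, rfl⟩
      simp
      refine ⟨Nat.pos_of_ne_zero (by rintro rfl; simp at hl), ?_⟩
      by_contra hc
      have h2 : p * q + q ≤ 2 * (q * j) := by rw [hh]; nlinarith
      omega
  · intro j _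
    simp [Nat.mul_div_cancel_left j hq]

theorem aux_res (m c d a : ℕ) [NeZero m] (hd : 1 ≤ d) (hcd : Nat.Coprime c d)
    (hm : Nat.Coprime d m) (ha : a = res m (-((c : ℚ) / d))) : m ∣ c + a * d := by
  have hn : (-((c : ℚ) / d)).num = -c := by
    rw [Rat.num_neg_eq_neg_num]
    have := Rat.num_div_eq_of_coprime (a := c) (b := d) (by omega) (by simpa using hcd)
    simpa using this
  have hdn : (-((c : ℚ) / d)).den = d := by
    rw [Rat.den_neg_eq_den]
    have := Rat.den_div_eq_of_coprime (a := c) (b := d) (by omega) (by simpa using hcd)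
    rw [Int.cast_natCast, Int.cast_natCast] at this
    exact Int.ofNat.inj this
  unfold res at ha
  rw [hn, hdn] at ha
  rw [← ZMod.natCast_eq_zero_iff, ha]
  push_cast
  rw [ZMod.natCast_val, ZMod.cast_id]
  have := ZMod.coe_mul_inv_eq_one d hm
  linear_combination (-(c : ZMod m)) * this

theorem stmt11 (c d s : ℕ) (hc1 : 1 ≤ c) (hcd : c ≤ d) (hs1 : 1 ≤ s) (hsd : s ≤ d)
    (hd : 2 ≤ d) (hgcd : Nat.gcd (c * s) d = 1)
    (p : ℕ) (hp : p.Prime) (hp5 : 5 ≤ p) (hps : p ≡ s [MOD d])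
    (α : ℚ) (hα : α = (c : ℚ) / d)
    (r : ℕ) (hr : 1 ≤ r)
    (a : ℕ) (ha : a = res (p ^ r) (-α)) :
    ratCongr p 3
      ((p : ℚ) ^ (2 * r) *
        ∑ l ∈ Finset.Icc 1 ((p ^ r - 1) / 2), 1 / (α + (a : ℚ) - (l : ℚ)) ^ 2)
      0 := by
  haveI : Fact p.Prime := ⟨hp⟩
  obtain ⟨k, rfl⟩ := Nat.exists_eq_add_of_le' hr
  have hcd' : Nat.Coprime c d := Nat.Coprime.coprime_mul_right hgcd
  have hsd' : Nat.Coprime s d := Nat.Coprime.coprime_mul_left hgcd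
  have hpd : Nat.Coprime p d := by
    unfold Nat.Coprime
    rw [hps.gcd_eq]; exact hsd'
  haveI : NeZero (p ^ (k + 1)) := ⟨pow_ne_zero _ hp.ne_zero⟩
  subst hα
  obtain ⟨n, hn⟩ := aux_res (p ^ (k + 1)) c d a (by omega) hcd' (hpd.symm.pow_right _) ha
  have hdu : IsUnit (d : ℤ_[p]) := by
    rw [PadicInt.isUnit_iff]
    exact PadicInt.norm_natCast_eq_one_iff.2 hpd
  obtain ⟨D, hD⟩ := hdu.exists_left_inv
  have hd0 : (d : ℚ_[p]) ≠ 0 := by exact_mod_cast (by omega : d ≠ 0)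
  have hp0 : (p : ℚ_[p]) ≠ 0 := by exact_mod_cast hp.ne_zero
  have hD' : (D : ℚ_[p]) * d = 1 := by exact_mod_cast congrArg (fun x : ℤ_[p] => (x : ℚ_[p])) hD
  have hn' : (c : ℚ_[p]) + a * d = p ^ (k + 1) * n := by exact_mod_cast hn
  have hw : (c : ℚ_[p]) / d + a = p ^ (k + 1) * (n * D) := by
    field_simp
    linear_combination hn' - (p : ℚ_[p]) ^ (k + 1) * n * hD'
  have hZ : ∀ l : ℕ, ∃ Z : ℤ_[p], l ∈ Finset.Icc 1 ((p ^ (k + 1) - 1) / 2) →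
      Z * ((p : ℤ_[p]) ^ (k + 1) * (n * D) - l) = (p : ℤ_[p]) ^ k ∧
      PadicInt.toZMod Z = if p ^ k ∣ l then -((l / p ^ k : ℕ) : ZMod p)⁻¹ else 0 := by
    intro l
    by_cases hl : l ∈ Finset.Icc 1 ((p ^ (k + 1) - 1) / 2)
    · have hl' := Finset.mem_Icc.1 hl
      obtain ⟨Z, h⟩ := aux_Z p k (n * D) l hl'.1 (by omega)
      exact ⟨Z, fun _ => h⟩
    · exact ⟨0, fun h => absurd h hl⟩
  choose Z hZ using hZ
  have hker : PadicInt.toZMod (∑ l ∈ Finset.Icc 1 ((p ^ (k + 1) - 1) / 2), Z l ^ 2) = 0 := by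
    rw [map_sum, ← aux_sum p hp5 (p ^ k) (pow_pos hp.pos k), pow_succ' p k]
    refine Finset.sum_congr rfl fun l hl => ?_
    rw [map_pow, (hZ l (by rwa [pow_succ' p k])).2]
  rw [← RingHom.mem_ker, PadicInt.ker_toZMod, PadicInt.maximalIdeal_eq_span_p,
    Ideal.mem_span_singleton] at hker
  obtain ⟨Y, hY⟩ := hker
  have hY' : ∑ l ∈ Finset.Icc 1 ((p ^ (k + 1) - 1) / 2), (Z l : ℚ_[p]) ^ 2 = p * Y := by
    have := congrArg (fun x : ℤ_[p] => (x : ℚ_[p])) hY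
    simpa using this
  set S : ℚ := (p : ℚ) ^ (2 * (k + 1)) *
        ∑ l ∈ Finset.Icc 1 ((p ^ (k + 1) - 1) / 2), 1 / ((c : ℚ) / d + (a : ℚ) - (l : ℚ)) ^ 2
    with hS
  have hSY : (S : ℚ_[p]) = p ^ 3 * Y := by
    rw [hS]
    push_cast
    rw [show (p : ℚ_[p]) ^ 3 * Y = p ^ 2 * (p * Y) by ring, ← hY', Finset.mul_sum, Finset.mul_sum]
    refine Finset.sum_congr rfl fun l hl => ?_
    have h1 := congrArg (fun x : ℤ_[p] => (x : ℚ_[p])) (hZ l hl).1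
    simp only [PadicInt.coe_mul, PadicInt.coe_sub, PadicInt.coe_pow, PadicInt.coe_natCast] at h1
    rw [hw]
    have hne : (p : ℚ_[p]) ^ (k + 1) * (n * D) - l ≠ 0 := by
      intro h0
      rw [h0, mul_zero] at h1
      exact pow_ne_zero k hp0 h1.symm
    rw [mul_one_div, div_eq_iff (pow_ne_zero 2 hne), mul_assoc, ← mul_pow, h1]
    ring
  unfold ratCongr
  by_cases hS0 : S = 0
  · exact Or.inl hS0
  · right
    rw [sub_zero]
    have hnorm : ‖(S : ℚ_[p])‖ ≤ (p : ℝ) ^ (-3 : ℤ) := by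
      rw [hSY, norm_mul, norm_pow, Padic.norm_p, zpow_neg, inv_pow]
      calc _ ≤ ((p : ℝ) ^ 3)⁻¹ * 1 := by gcongr; exact PadicInt.norm_le_one Y
        _ = _ := by rw [mul_one]; norm_cast
    rw [Padic.eq_padicNorm, padicNorm.eq_zpow_of_nonzero hS0] at hnorm
    push_cast at hnorm
    rw [zpow_le_zpow_iff_right₀ (by exact_mod_cast hp.one_lt)] at hnorm
    omega
end
end

section
/- Define, for a rational number x and a natural number k, F(x,k) = (2k+x) · (x)_k^3 (1/2)_k / ((1)_k^3 (1/2+x)_k) and G(x,k) = (k^3 (k+2x)/x^3) · (x)_k^3 (1/2)_k / ((1)_k^3 (1/2+x)_k). Then for every natural number k and every rational x with x ≠ 0 and x ∉ {−1/2, −3/2, −5/2, …}, one has F(x+1,k) − F(x,k) = G(x,k+1) − G(x,k); that is, (F, G) forms a WZ pair. -/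
noncomputable section

/-- `F(x,k) = (2k+x) (x)_k^3 (1/2)_k / ((1)_k^3 (1/2+x)_k)`. -/
def Fwz (x : ℚ) (k : ℕ) : ℚ :=
  (2 * (k : ℚ) + x) * poch x k ^ 3 * poch (1/2) k /
    (poch 1 k ^ 3 * poch (1/2 + x) k)

/-- `G(x,k) = (k^3 (k+2x)/x^3) (x)_k^3 (1/2)_k / ((1)_k^3 (1/2+x)_k)`. -/
def Gwz (x : ℚ) (k : ℕ) : ℚ :=
  ((k : ℚ) ^ 3 * ((k : ℚ) + 2 * x) / x ^ 3) * poch x k ^ 3 * poch (1/2) k /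
    (poch 1 k ^ 3 * poch (1/2 + x) k)

theorem poch_succ (x : ℚ) (k : ℕ) : poch x (k + 1) = poch x k * (x + k) := by
  simp [poch, Finset.prod_range_succ]

theorem poch_shift (x : ℚ) (k : ℕ) : x * poch (x + 1) k = poch x k * (x + k) := by
  rw [← poch_succ]
  simp only [poch, Finset.prod_range_succ']
  rw [mul_comm]
  push_cast
  congr 1
  · apply Finset.prod_congr rfl
    intros
    ring
  · ring

theorem stmt12 (x : ℚ) (hx0 : x ≠ 0) (hx : ∀ n : ℕ, x ≠ -(1/2) - (n : ℚ)) (k : ℕ) :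
    Fwz (x + 1) k - Fwz x k = Gwz x (k + 1) - Gwz x k := by
  have ha : ∀ n : ℕ, 1/2 + x + (n : ℚ) ≠ 0 := fun n h => hx n (by linarith)
  have h1 : poch 1 k ≠ 0 := by
    refine Finset.prod_ne_zero_iff.2 fun i _ => ?_
    positivity
  have h2 : poch (1/2 + x) k ≠ 0 := Finset.prod_ne_zero_iff.2 fun i _ => ha i
  have a0 : 1/2 + x ≠ 0 := by simpa using ha 0
  have ak := ha k
  have hk : (1 : ℚ) + k ≠ 0 := by positivity
  have e1 : poch (x + 1) k = poch x k * (x + k) / x := by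
    rw [eq_div_iff hx0, ← poch_shift]; ring
  have e2 : poch (1/2 + (x + 1)) k = poch (1/2 + x) k * (1/2 + x + k) / (1/2 + x) := by
    rw [eq_div_iff a0, ← poch_shift, ← add_assoc]; ring
  unfold Fwz Gwz
  rw [e1, e2]
  simp only [poch_succ]
  push_cast
  generalize poch 1 k = A at *
  generalize poch (1/2 + x) k = B at *
  generalize poch x k = C at *
  generalize poch (1/2) k = D at *
  generalize (k : ℚ) = K at *
  obtain ⟨a, rfl⟩ : ∃ a, x = a - 1/2 := ⟨x + 1/2, by ring⟩
  have q : 1/2 + (a - 1/2) = a := by ring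
  simp only [q] at *
  generalize hy : a - 1/2 = y at *
  obtain rfl : a = y + 1/2 := by linarith
  have l : (y + 1 / 2 + K) ≠ 0 := ak
  have t1 : (2 * K + (y + 1)) * (C * (y + K) / y) ^ 3 * D / (A ^ 3 * (B * (y + 1/2 + K) / (y + 1/2)))
    = (C^3 * D / (A^3 * B * y^3)) * ((2 * K + (y + 1)) * (y+K)^3 * (y+1/2) / (y+1/2+K)) := by
    rw [div_pow, mul_div_assoc', div_mul_eq_mul_div, mul_div_assoc', div_div_div_eq, div_mul_div_comm]
    congr 1 <;> ring
  have t2 : ((K + 1) ^ 3 * (K + 1 + 2 * y) / y ^ 3) * (C * (y + K)) ^ 3 * (D * (1/2 + K)) / ((A * (1 + K)) ^ 3 * (B * (y + 1/2 + K)))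
    = (C^3 * D / (A^3 * B * y^3)) * ((K + 1 + 2 * y) * (y+K)^3 * (1/2+K) / (y+1/2+K)) := by
    rw [div_mul_eq_mul_div, div_mul_eq_mul_div, div_div, div_mul_div_comm, div_eq_div_iff (by positivity) (by positivity)]
    ring
  have t3 : (2 * K + y) * C ^ 3 * D / (A ^ 3 * B) = (C^3 * D / (A^3 * B * y^3)) * ((2*K+y)*y^3) := by
    rw [div_mul_eq_mul_div, div_eq_div_iff (by positivity) (by positivity)]
    ring
  have t4 : (K ^ 3 * (K + 2 * y) / y ^ 3) * C ^ 3 * D / (A ^ 3 * B) = (C^3 * D / (A^3 * B * y^3)) * (K^3*(K+2*y)) := by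
    rw [div_mul_eq_mul_div, div_mul_eq_mul_div, div_div, div_mul_eq_mul_div, div_eq_div_iff (by positivity) (by positivity)]
    ring
  rw [t1, t2, t3, t4, ← mul_sub, ← mul_sub]
  congr 1
  rw [sub_eq_sub_iff_sub_eq_sub, ← sub_div, div_eq_iff l]
  ring
end
end

section
/- Let c, d, s be positive integers with d ≥ 2, 1 ≤ c, s ≤ d and gcd(cs, d) = 1, let p ≥ 5 be a prime with p ≡ s (mod d), set α = c/d, and let r be a positive integer with (1/2+α)^{*_r} · (1/2 + α^{*_r}) ≢ 0 (mod p). Then ∑_{k=0}^{p^r−1} (2k + α^{*_r} p^r) · (α^{*_r} p^r)_k^3 (1/2)_k / ((1)_k^3 (1/2 + α^{*_r} p^r)_k) ≡ α^{*_r} p^r (mod p^{r+3}). -/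
noncomputable section

def VV (p : ℕ) (m : ℤ) (u : ℚ) : Prop := padicNorm p u ≤ (p : ℚ) ^ (-m)

section VVsec
variable {p : ℕ} [hpf : Fact p.Prime]

lemma VV_pone : (1 : ℚ) < p := by exact_mod_cast hpf.out.one_lt

lemma VV_zero (m : ℤ) : VV p m 0 := by
  have := VV_pone (p := p)
  unfold VV
  rw [padicNorm.zero]
  positivity

lemma VV_add {m : ℤ} {u v : ℚ} (hu : VV p m u) (hv : VV p m v) : VV p m (u + v) :=
  le_trans padicNorm.nonarchimedean (max_le hu hv)

lemma VV_neg {m : ℤ} {u : ℚ} (hu : VV p m u) : VV p m (-u) := by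
  unfold VV; rw [padicNorm.neg]; exact hu

lemma VV_sub {m : ℤ} {u v : ℚ} (hu : VV p m u) (hv : VV p m v) : VV p m (u - v) := by
  rw [sub_eq_add_neg]; exact VV_add hu (VV_neg hv)

lemma VV_mul' {m n : ℤ} {u v : ℚ} (hu : VV p m u) (hv : VV p n v) : VV p (m + n) (u * v) := by
  have := VV_pone (p := p)
  unfold VV at *
  rw [padicNorm.mul, neg_add, zpow_add₀ (by positivity)]
  exact mul_le_mul hu hv (padicNorm.nonneg _) (by positivity)

lemma VV_mono {m n : ℤ} {u : ℚ} (hu : VV p m u) (h : n ≤ m) : VV p n u :=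
  le_trans hu (zpow_le_zpow_right₀ (VV_pone (p := p)).le (by omega))

lemma VV_mul {m n k : ℤ} {u v : ℚ} (hu : VV p m u) (hv : VV p n v) (h : k ≤ m + n) :
    VV p k (u * v) := VV_mono (VV_mul' hu hv) h

lemma VV_sum {ι : Type*} {m : ℤ} (s : Finset ι) (f : ι → ℚ) (h : ∀ i ∈ s, VV p m (f i)) :
    VV p m (∑ i ∈ s, f i) := by
  classical
  induction s using Finset.induction_on with
  | empty => simpa using VV_zero m
  | insert a s ha ih =>
    rw [Finset.sum_insert ha]
    exact VV_add (h _ (Finset.mem_insert_self _ _))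
      (ih fun i hi => h i (Finset.mem_insert_of_mem hi))

lemma VV_int (z : ℤ) : VV p 0 (z : ℚ) := by
  simpa [VV] using padicNorm.of_int (p := p) z

lemma VV_nat (z : ℕ) : VV p 0 (z : ℚ) := by exact_mod_cast VV_int (p := p) (z : ℤ)

lemma VV_one : VV p 0 (1 : ℚ) := by exact_mod_cast VV_nat (p := p) 1

lemma VV_ppow (r : ℕ) : VV p r ((p : ℚ) ^ r) := by
  unfold VV
  have hp0 : (p : ℚ) ≠ 0 := by exact_mod_cast hpf.out.ne_zero
  rw [padicNorm.eq_zpow_of_nonzero (pow_ne_zero _ hp0), padicValRat.pow,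
    padicValRat.self hpf.out.one_lt, mul_one]

lemma VV_pow {m : ℤ} {u : ℚ} (hu : VV p m u) (n : ℕ) : VV p (m * n) (u ^ n) := by
  induction n with
  | zero => simpa using VV_one
  | succ n ih =>
    rw [pow_succ]
    exact VV_mul ih hu (by push_cast; ring_nf; omega)

lemma VV_iff {m : ℤ} {u : ℚ} : VV p m u ↔ u = 0 ∨ m ≤ padicValRat p u := by
  by_cases h : u = 0
  · subst h; simp [VV_zero]
  · unfold VV
    rw [padicNorm.eq_zpow_of_nonzero h, zpow_le_zpow_iff_right₀ (VV_pone (p := p))]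
    simp [h]

lemma VV_congr {m : ℤ} {u v : ℚ} : ratCongr p m u v ↔ VV p m (u - v) := by
  rw [VV_iff, sub_eq_zero]; rfl

lemma VV_inv_unit {u : ℚ} (h : padicNorm p u = 1) : VV p 0 (1 / u) := by
  unfold VV
  rw [padicNorm.div, h]; simp

lemma VV_prod_one {ι : Type*} (s : Finset ι) (f : ι → ℚ) (h : ∀ i ∈ s, VV p 1 (f i - 1)) :
    VV p 1 (∏ i ∈ s, f i - 1) := by
  classical
  induction s using Finset.induction_on with
  | empty => simpa using VV_zero 1
  | insert a s ha ih =>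
    rw [Finset.prod_insert ha]
    have h1 := h a (Finset.mem_insert_self _ _)
    have h2 := ih fun i hi => h i (Finset.mem_insert_of_mem hi)
    have : f a * ∏ i ∈ s, f i - 1 = (f a - 1) * (∏ i ∈ s, f i - 1) + (f a - 1)
        + (∏ i ∈ s, f i - 1) := by ring
    rw [this]
    exact VV_add (VV_add (VV_mul h1 h2 (by norm_num)) h1) h2

lemma VV_of_one {u : ℚ} (h : VV p 1 (u - 1)) : VV p 0 u := by
  have := VV_add (VV_mono h (by norm_num : (0:ℤ) ≤ 1)) VV_one
  simpa using this

lemma VV_one_add_norm {y : ℚ} (h : VV p 1 y) : padicNorm p (1 + y) = 1 := by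
  have hy : padicNorm p y < 1 := by
    refine lt_of_le_of_lt h ?_
    exact zpow_lt_one_of_neg₀ VV_pone (by norm_num)
  rw [padicNorm.add_eq_max_of_ne (by rw [padicNorm.one]; exact hy.ne'), padicNorm.one]
  exact max_eq_left hy.le

lemma VV_inv_one_add {y : ℚ} (h : VV p 1 y) : VV p 1 (1 / (1 + y) - 1) := by
  have h1 := VV_one_add_norm h
  have h0 : 1 + y ≠ 0 := by
    intro h0; rw [h0, padicNorm.zero] at h1; norm_num at h1
  have : 1 / (1 + y) - 1 = -(y * (1 / (1 + y))) := by field_simp; ring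
  rw [this]
  exact VV_neg (VV_mul h (VV_inv_unit h1) (by norm_num))

lemma VV_inv_nat {r m : ℕ} (h : ¬ p ^ r ∣ m) : VV p (1 - r) (1 / (m : ℚ)) := by
  have hm : m ≠ 0 := by rintro rfl; simp at h
  have hm' : (m : ℚ) ≠ 0 := by exact_mod_cast hm
  rw [VV_iff]; right
  rw [padicValRat.div one_ne_zero hm', padicValRat.one, padicValRat.of_nat]
  rw [padicValNat_dvd_iff_le hm] at h
  omega

lemma VV_inv_small {q : ℕ} (hq : q ≠ 0) (hqp : q < p) : VV p 0 (1 / (q : ℚ)) := by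
  have := VV_inv_nat (p := p) (r := 1) (m := q)
    (by rw [pow_one]; intro h; exact absurd (Nat.le_of_dvd (by omega) h) (by omega))
  simpa using this

lemma VV_den {u : ℚ} (h : VV p 0 u) : ¬ p ∣ u.den := by
  have : padicNorm p u ≤ 1 := by simpa [VV] using h
  have h2 := (padicNorm.int_eq_one_iff (p := p) (u.den : ℤ))
  intro hd
  have hn : ¬ (p : ℤ) ∣ u.num := by
    intro hn
    have := Nat.dvd_gcd (Int.natCast_dvd.mp hn) hd
    rw [u.reduced.gcd_eq_one] at this
    exact hpf.out.one_lt.ne' (Nat.dvd_one.mp this)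
  have hn1 : padicNorm p (u.num : ℚ) = 1 := (padicNorm.int_eq_one_iff _).2 hn
  have hd1 : padicNorm p (u.den : ℚ) < 1 := by
    have := (padicNorm.int_lt_one_iff (p := p) (u.den : ℤ)).2 (by exact_mod_cast hd)
    exact_mod_cast this
  have : padicNorm p u * padicNorm p (u.den : ℚ) = 1 := by
    rw [← padicNorm.mul, Rat.mul_den_eq_num, hn1]
  nlinarith [padicNorm.nonneg (p := p) u, padicNorm.nonneg (p := p) (u.den : ℚ)]

lemma VV_dash {x : ℚ} (h : VV p 0 x) : VV p 0 (dash p x) := by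
  have hd := VV_den h
  have hden : ((x.den : ℕ) : ZMod p) ≠ 0 := by
    rwa [Ne, ZMod.natCast_eq_zero_iff]
  have key : (p : ℤ) ∣ x.num + (res p (-x) : ℤ) * x.den := by
    rw [← ZMod.intCast_zmod_eq_zero_iff_dvd]
    push_cast
    unfold res
    rw [ZMod.natCast_zmod_val]
    simp only [Rat.neg_num, Rat.neg_den]
    push_cast
    field_simp
    ring
  obtain ⟨z, hz⟩ := key
  have hp0 : (p : ℚ) ≠ 0 := by exact_mod_cast hpf.out.ne_zero
  have hx0 : (x.den : ℚ) ≠ 0 := by exact_mod_cast x.den_ne_zero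
  have : dash p x = z * (1 / (x.den : ℚ)) := by
    unfold dash
    have hz' : (x.num : ℚ) + (res p (-x) : ℚ) * x.den = p * z := by exact_mod_cast hz
    have hx : x * x.den = x.num := Rat.mul_den_eq_num x
    field_simp
    rw [← hz', ← hx]; ring
  rw [this]
  have h1 := VV_inv_nat (p := p) (r := 1) (m := x.den) (by simpa using hd)
  exact VV_mul (VV_int z) h1 (by norm_num)

lemma VV_dashIter {x : ℚ} (h : VV p 0 x) (r : ℕ) : VV p 0 (dashIter p r x) := by
  unfold dashIter
  induction r with
  | zero => simpa using h
  | succ r ih => rw [Function.iterate_succ_apply']; exact VV_dash ih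

lemma H_split1 (F : ℕ → ℚ) (n : ℕ) : ∑ i ∈ Finset.range (2 * n), F i
    = ∑ i ∈ Finset.range n, (F i + F (n + (n - 1 - i))) := by
  rw [two_mul, Finset.sum_range_add, Finset.sum_add_distrib,
    Finset.sum_range_reflect (fun i => F (n + i))]

lemma H_split2 (F : ℕ → ℚ) (n : ℕ) : ∑ i ∈ Finset.range (2 * n), F i
    = ∑ i ∈ Finset.range n, (F (2 * i + 1) + F (2 * (n - 1 - i))) := by
  rw [Finset.sum_add_distrib, Finset.sum_range_reflect (fun i => F (2 * i))]
  induction n with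
  | zero => simp
  | succ n ih =>
    rw [Finset.sum_range_succ (n := n), Finset.sum_range_succ (n := n), mul_add, mul_one,
      Finset.sum_range_succ, Finset.sum_range_succ, ih]
    ring

lemma pair_diff {r k l : ℕ} (hr : 1 ≤ r) (hk : 0 < k) (hl : 0 < l) (hkl : k + l = p ^ r) :
    VV p (3 - 2 * r) (1 / (l : ℚ) ^ 2 - 1 / (k : ℚ) ^ 2) := by
  have h1 := VV_inv_nat (p := p) (r := r) (m := k)
    (fun h => absurd (Nat.le_of_dvd hk h) (by omega))
  have h2 := VV_inv_nat (p := p) (r := r) (m := l)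
    (fun h => absurd (Nat.le_of_dvd hl h) (by omega))
  have hk0 : (k : ℚ) ≠ 0 := by exact_mod_cast hk.ne'
  have hl0 : (l : ℚ) ≠ 0 := by exact_mod_cast hl.ne'
  have hN : (k : ℚ) + l = (p : ℚ) ^ r := by exact_mod_cast hkl
  have : 1 / (l : ℚ) ^ 2 - 1 / (k : ℚ) ^ 2 =
      (p : ℚ) ^ r * ((1 / (l : ℚ)) * (1 / (k : ℚ))) * (1 / (l : ℚ) - 1 / (k : ℚ)) := by
    rw [← hN]; field_simp; ring
  rw [this]
  exact VV_mul (VV_mul' (VV_ppow r) (VV_mul' h2 h1)) (VV_sub h2 h1) (by omega)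

lemma H_zero {r n : ℕ} (hr : 1 ≤ r) (hp5 : 5 ≤ p) (hn : 2 * n + 1 = p ^ r) :
    VV p (3 - 2 * r) (∑ i ∈ Finset.range n, 1 / ((i : ℚ) + 1) ^ 2) ∧
    VV p (3 - 2 * r) (∑ i ∈ Finset.range (2 * n), 1 / ((i : ℚ) + 1) ^ 2) := by
  set h := ∑ i ∈ Finset.range n, 1 / ((i : ℚ) + 1) ^ 2 with hh
  set H := ∑ i ∈ Finset.range (2 * n), 1 / ((i : ℚ) + 1) ^ 2 with hH
  have e1 : VV p (3 - 2 * r) (H - 2 * h) := by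
    rw [hH, H_split1, hh, Finset.mul_sum, ← Finset.sum_sub_distrib]
    refine VV_sum _ _ fun i hi => ?_
    have hi := Finset.mem_range.1 hi
    have := pair_diff (p := p) (r := r) (k := i + 1) (l := n + (n - 1 - i) + 1) hr
      (by omega) (by omega) (by omega)
    convert this using 1
    push_cast
    ring
  have e2 : VV p (3 - 2 * r) (H - h / 2) := by
    rw [hH, H_split2, hh, Finset.sum_div, ← Finset.sum_sub_distrib]
    refine VV_sum _ _ fun i hi => ?_
    have hi := Finset.mem_range.1 hi
    have := pair_diff (p := p) (r := r) (k := 2 * i + 2) (l := 2 * (n - 1 - i) + 1) hr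
      (by omega) (by omega) (by omega)
    convert this using 1
    have : (i : ℚ) + 1 ≠ 0 := by positivity
    push_cast
    have e : (2 * (i : ℚ) + 1 + 1) = 2 * (i + 1) := by ring
    have e' : (2 * (i : ℚ) + 2) = 2 * (i + 1) := by ring
    rw [e, e', mul_pow]
    field_simp
    ring
  have h3 : VV p 0 (1 / ((3 : ℕ) : ℚ)) := VV_inv_small (by norm_num) (by omega)
  have eh : VV p (3 - 2 * r) h := by
    have := VV_mul (VV_mul (VV_sub e2 e1) (VV_nat 2) le_rfl) h3 le_rfl
    simp only [add_zero] at this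
    convert this using 1
    push_cast; ring
  refine ⟨eh, ?_⟩
  have := VV_add e1 (VV_mul (VV_nat 2) eh (zero_add _).ge)
  convert this using 1
  push_cast; ring

lemma W_fac {r n : ℕ} {a : ℚ} (ha : VV p 0 a) (hn : 2 * n + 1 = p ^ r) {i : ℕ}
    (hi : i < 2 * n + 1) (hin : i ≠ n) :
    VV p 1 ((1 / 2 + (i : ℚ)) / (1 / 2 + a * (p : ℚ) ^ r + i) - 1) := by
  have hnd : ¬ p ^ r ∣ 2 * i + 1 := by
    rw [← hn]
    rintro ⟨c, hc⟩
    have : c = 1 := by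
      rcases c with _ | _ | c
      · omega
      · rfl
      · exfalso; nlinarith
    subst this; omega
  have h1 := VV_inv_nat hnd
  have h0 : ((2 * i + 1 : ℕ) : ℚ) ≠ 0 := by exact_mod_cast Nat.succ_ne_zero (2 * i)
  have hy : VV p 1 (a * (p : ℚ) ^ r * (((2 : ℕ) : ℚ) * (1 / ((2 * i + 1 : ℕ) : ℚ)))) :=
    VV_mul (VV_mul' ha (VV_ppow r)) (VV_mul' (VV_nat 2) h1) (by omega)
  have h2 := VV_inv_one_add hy
  convert h2 using 2
  have hu : (1 / 2 + (i : ℚ)) ≠ 0 := by positivity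
  have : 1 / 2 + a * (p : ℚ) ^ r + i = (1 / 2 + (i : ℚ)) *
    (1 + a * (p : ℚ) ^ r * (((2 : ℕ) : ℚ) * (1 / ((2 * i + 1 : ℕ) : ℚ)))) := by
    push_cast at h0 ⊢
    field_simp
    ring
  rw [this, ← div_div, div_self hu]

lemma W_all {r n : ℕ} {a : ℚ} (ha : VV p 0 a) (hn : 2 * n + 1 = p ^ r)
    (hb : VV p 0 (1 / (1 + 2 * a))) {k : ℕ} (hk : k ≤ 2 * n + 1) :
    VV p 1 (poch (1 / 2) k / poch (1 / 2 + a * (p : ℚ) ^ r) k -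
      if k ≤ n then 1 else 1 / (1 + 2 * a)) := by
  unfold poch
  rw [← Finset.prod_div_distrib]
  split_ifs with h
  · refine VV_prod_one _ _ fun i hi => ?_
    have hi := Finset.mem_range.1 hi
    exact W_fac ha hn (by omega) (by omega)
  · rw [← Finset.mul_prod_erase _ _ (Finset.mem_range.2 (by omega : n < k))]
    have hN : 2 * (n : ℚ) + 1 = (p : ℚ) ^ r := by exact_mod_cast hn
    have e : (1 / 2 + (n : ℚ)) / (1 / 2 + a * (p : ℚ) ^ r + n) = 1 / (1 + 2 * a) := by
      rw [← hN]
      have hu : (1 / 2 + (n : ℚ)) ≠ 0 := by positivity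
      have : 1 / 2 + a * (2 * n + 1) + (n : ℚ) = (1 / 2 + (n : ℚ)) * (1 + 2 * a) := by ring
      rw [this, ← div_div, div_self hu]
    rw [e]
    have := VV_prod_one (p := p) ((Finset.range k).erase n)
      (fun i => (1 / 2 + (i : ℚ)) / (1 / 2 + a * (p : ℚ) ^ r + i)) (fun i hi => by
        have hi' := Finset.mem_erase.1 hi
        have hi2 := Finset.mem_range.1 hi'.2
        exact W_fac ha hn (by omega) hi'.1)
    have := VV_mul hb this (by norm_num : (1 : ℤ) ≤ 0 + 1)
    rw [mul_sub, mul_one] at this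
    exact this

lemma P_all {r : ℕ} {x : ℚ} (hx : VV p r x) {j : ℕ} (hj : j < p ^ r) :
    VV p 1 (∏ i ∈ Finset.range j, ((x + ((i + 1 : ℕ) : ℚ)) / (1 + i)) - 1) := by
  refine VV_prod_one _ _ fun i hi => ?_
  have hi := Finset.mem_range.1 hi
  have h1 := VV_inv_nat (p := p) (r := r) (m := i + 1)
    (fun h => absurd (Nat.le_of_dvd (by omega) h) (by omega))
  have := VV_mul hx h1 (by omega : (1 : ℤ) ≤ r + (1 - r))
  convert this using 1
  have : 1 + (i : ℚ) ≠ 0 := by positivity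
  have : (i : ℚ) + 1 ≠ 0 := by positivity
  push_cast
  field_simp
  ring

lemma poch_ratio (x : ℚ) (j : ℕ) : poch x (j + 1) / poch 1 (j + 1) =
    x * (1 / ((j + 1 : ℕ) : ℚ)) *
      ∏ i ∈ Finset.range j, ((x + ((i + 1 : ℕ) : ℚ)) / (1 + i)) := by
  unfold poch
  rw [Finset.prod_range_succ', Finset.prod_range_succ (fun i : ℕ => (1 : ℚ) + i),
    Finset.prod_div_distrib]
  push_cast
  rw [mul_div_mul_comm, add_zero, add_comm 1 (j : ℚ)]
  ring

lemma term_cong {r n : ℕ} {a : ℚ} (ha : VV p 0 a) (hn : 2 * n + 1 = p ^ r)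
    (hb : VV p 0 (1 / (1 + 2 * a))) {j : ℕ} (hj : j < 2 * n) :
    VV p (r + 3) ((2 * ((j + 1 : ℕ) : ℚ) + a * (p : ℚ) ^ r) *
          poch (a * (p : ℚ) ^ r) (j + 1) ^ 3 * poch (1/2) (j + 1) /
            (poch 1 (j + 1) ^ 3 * poch (1/2 + a * (p : ℚ) ^ r) (j + 1))
       - 2 * (a * (p : ℚ) ^ r) ^ 3 * ((if j + 1 ≤ n then 1 else 1 / (1 + 2 * a)) *
          (1 / ((j : ℚ) + 1) ^ 2))) := by
  have hx : VV p r (a * (p : ℚ) ^ r) := VV_mul ha (VV_ppow r) (by omega)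
  set x := a * (p : ℚ) ^ r with hxd
  have hW := W_all (p := p) ha hn hb (k := j + 1) (by omega)
  rw [← hxd] at hW
  have hP := P_all (p := p) hx (j := j) (by omega)
  have hR := poch_ratio x j
  have hK := VV_inv_nat (p := p) (r := r) (m := j + 1)
    (fun h => absurd (Nat.le_of_dvd (by omega) h) (by omega))
  have hw : VV p 0 (if j + 1 ≤ n then (1 : ℚ) else 1 / (1 + 2 * a)) := by
    split_ifs
    · exact VV_one
    · exact hb
  set w : ℚ := (if j + 1 ≤ n then (1 : ℚ) else 1 / (1 + 2 * a))
  set P := ∏ i ∈ Finset.range j, ((x + ((i + 1 : ℕ) : ℚ)) / (1 + i))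
  have hk0 : ((j + 1 : ℕ) : ℚ) ≠ 0 := by exact_mod_cast Nat.succ_ne_zero j
  have e1 : ∀ A B C D E : ℚ, A * B ^ 3 * C / (D ^ 3 * E) = A * (B / D) ^ 3 * (C / E) := by
    intros; rw [mul_div_mul_comm, div_pow]; ring
  rw [e1, hR]
  set W := poch (1 / 2) (j + 1) / poch (1 / 2 + x) (j + 1)
  have hcast : ((j : ℚ) + 1) = ((j + 1 : ℕ) : ℚ) := by push_cast; ring
  rw [hcast]
  set K := ((j + 1 : ℕ) : ℚ)
  have hP3 : VV p 1 (P ^ 3 - 1) := by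
    have := VV_prod_one (p := p) (Finset.range 3) (fun _ => P) (fun _ _ => hP)
    simpa using this
  have hP0 : VV p 0 (P ^ 3) := VV_of_one hP3
  have hW0 : VV p 0 W := by
    have := VV_add (VV_mono hW (by norm_num : (0 : ℤ) ≤ 1)) hw
    simpa using this
  have hxK : VV p 1 (x * (1 / K)) := VV_mul hx hK (by omega)
  have hx3 : VV p (r * (3 : ℕ)) (x ^ 3) := VV_pow hx 3
  have hmain : VV p 1 (x * (1 / K) * (P ^ 3 * W) + ((2 : ℕ) : ℚ) * ((P ^ 3 - 1) * W + (W - w))) :=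
    VV_add (VV_mul hxK (VV_mul' hP0 hW0) (by norm_num))
      (VV_mul (VV_nat 2) (VV_add (VV_mul hP3 hW0 (by norm_num : (1 : ℤ) ≤ 1 + 0)) hW)
        (by norm_num))
  have := VV_mul (VV_mul' hx3 (VV_mul' hK hK)) hmain
    (by push_cast; omega : (r : ℤ) + 3 ≤ _)
  convert this using 1
  push_cast
  field_simp
  ring

end VVsec

theorem stmt13 (c d s : ℕ) (hc1 : 1 ≤ c) (hcd : c ≤ d) (hs1 : 1 ≤ s) (hsd : s ≤ d)
    (hd : 2 ≤ d) (hgcd : Nat.gcd (c * s) d = 1)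
    (p : ℕ) (hp : p.Prime) (hp5 : 5 ≤ p) (hps : p ≡ s [MOD d])
    (α : ℚ) (hα : α = (c : ℚ) / d)
    (r : ℕ) (hr : 1 ≤ r)
    (hnd : ¬ ratCongr p 1 (dashIter p r (1/2 + α) * (1/2 + dashIter p r α)) 0) :
    ratCongr p ((r : ℤ) + 3)
      (∑ k ∈ Finset.range (p ^ r),
        (2 * (k : ℚ) + dashIter p r α * (p : ℚ) ^ r) *
          poch (dashIter p r α * (p : ℚ) ^ r) k ^ 3 * poch (1/2) k /
            (poch 1 k ^ 3 * poch (1/2 + dashIter p r α * (p : ℚ) ^ r) k))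
      (dashIter p r α * (p : ℚ) ^ r) := by
  haveI : Fact p.Prime := ⟨hp⟩
  have hcop : Nat.Coprime s d := by
    have : Nat.Coprime (c * s) d := hgcd
    exact Nat.Coprime.coprime_mul_left this
  have hpd : Nat.Coprime p d := by
    unfold Nat.Coprime at *
    rw [hps.gcd_eq]; exact hcop
  have hαi : VV p 0 α := by
    have h1 := VV_inv_nat (p := p) (r := 1) (m := d)
      (by rw [pow_one]; exact (Nat.Prime.coprime_iff_not_dvd hp).1 hpd)
    rw [hα, div_eq_mul_one_div]
    exact VV_mul (VV_nat c) h1 (by norm_num)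
  have hhalf : VV p 0 (1 / 2 : ℚ) := by
    have := VV_inv_small (p := p) (q := 2) (by norm_num) (by omega)
    exact_mod_cast this
  have hA : VV p 0 (dashIter p r (1 / 2 + α)) := VV_dashIter (VV_add hhalf hαi) r
  have ha : VV p 0 (dashIter p r α) := VV_dashIter hαi r
  set a := dashIter p r α
  rw [VV_congr, sub_zero] at hnd
  have hB1 : ¬ VV p 1 (1 / 2 + a) := fun h => hnd (VV_mul hA h (by norm_num))
  have hb : VV p 0 (1 / (1 + 2 * a)) := by
    rw [VV_iff] at hB1 hhalf ⊢
    push Not at hB1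
    obtain ⟨h0, h1⟩ := hB1
    right
    have : 1 / (1 + 2 * a) = (1 / 2) / (1 / 2 + a) := by
      have e : 1 + 2 * a = 2 * (1 / 2 + a) := by ring
      rw [e]; field_simp
    rw [this, padicValRat.div (by norm_num) h0]
    have := hhalf.resolve_left (by norm_num)
    omega
  have hodd : Odd (p ^ r) := (hp.odd_of_ne_two (by omega)).pow
  obtain ⟨n, hn⟩ := hodd
  obtain ⟨H1, H2'⟩ := H_zero (p := p) (r := r) (n := n) hr hp5 hn.symm
  rw [VV_congr, hn, Finset.sum_range_succ']
  have t0 : (2 * ((0 : ℕ) : ℚ) + a * (p : ℚ) ^ r) *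
          poch (a * (p : ℚ) ^ r) 0 ^ 3 * poch (1/2) 0 /
            (poch 1 0 ^ 3 * poch (1/2 + a * (p : ℚ) ^ r) 0) = a * (p : ℚ) ^ r := by
    simp [poch]
  rw [t0, add_sub_cancel_right]
  have hx : VV p r (a * (p : ℚ) ^ r) := VV_mul ha (VV_ppow r) (by omega)
  have hx3 := VV_pow hx 3
  have hS := VV_sum (p := p) (Finset.range (2 * n)) _
    (fun j hj => term_cong (p := p) (r := r) (n := n) ha hn.symm hb (Finset.mem_range.1 hj))
  rw [Finset.sum_sub_distrib, ← Finset.mul_sum] at hS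
  have hw : ∑ j ∈ Finset.range (2 * n), ((if j + 1 ≤ n then 1 else 1 / (1 + 2 * a)) *
          (1 / ((j : ℚ) + 1) ^ 2)) =
      1 / (1 + 2 * a) * ∑ i ∈ Finset.range (2 * n), 1 / ((i : ℚ) + 1) ^ 2 +
      (1 - 1 / (1 + 2 * a)) * ∑ i ∈ Finset.range n, 1 / ((i : ℚ) + 1) ^ 2 := by
    have s1 : ∑ j ∈ Finset.range n, ((if j + 1 ≤ n then 1 else 1 / (1 + 2 * a)) *
          (1 / ((j : ℚ) + 1) ^ 2)) = ∑ i ∈ Finset.range n, 1 / ((i : ℚ) + 1) ^ 2 :=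
      Finset.sum_congr rfl
        (fun i hi => by rw [if_pos (by have := Finset.mem_range.1 hi; omega), one_mul])
    have s2 : ∑ j ∈ Finset.range n, ((if n + j + 1 ≤ n then 1 else 1 / (1 + 2 * a)) *
          (1 / (((n + j : ℕ) : ℚ) + 1) ^ 2)) =
        1 / (1 + 2 * a) * ∑ j ∈ Finset.range n, (1 / (((n + j : ℕ) : ℚ) + 1) ^ 2) := by
      rw [Finset.mul_sum]
      exact Finset.sum_congr rfl (fun i hi => by rw [if_neg (by omega)])
    rw [two_mul, Finset.sum_range_add, Finset.sum_range_add, s1, s2]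
    ring
  rw [hw] at hS
  have hT : VV p (r + 3) (((2 : ℕ) : ℚ) * (a * (p : ℚ) ^ r) ^ 3 *
      (1 / (1 + 2 * a) * ∑ i ∈ Finset.range (2 * n), 1 / ((i : ℚ) + 1) ^ 2 +
      (1 - 1 / (1 + 2 * a)) * ∑ i ∈ Finset.range n, 1 / ((i : ℚ) + 1) ^ 2)) :=
    VV_mul (VV_mul' (VV_nat 2) hx3)
      (VV_add (VV_mul hb H2' le_rfl) (VV_mul (VV_sub VV_one hb) H1 le_rfl))
      (by push_cast; omega)
  have := VV_add hS hT
  rw [Nat.cast_ofNat, sub_add_cancel] at this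
  exact this
end
end
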